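/- arXiv:0809.0477 — 2 statements merged into one kernel-verified Lean document; each statement's English description precedes it below -/
import Mathlib

section
/- Let α ≥ 0 and let (α_n) be a nonincreasing sequence of positive numbers with α_n ↓ α. Let (h_{α_n}) be Borel measurable functions E → ℝ that are uniformly bounded below by −K_h (i.e. h_{α_n}(y) ≥ −K_h for all y and n), and set h := liminf_{n→∞} h_{α_n} pointwise. Fix x ∈ E and let Θ_n = (μ_n, μ_{∂,n}) ∈ 𝕍^r(x) and Θ = (μ, μ_∂) ∈ 𝕍^r(x) be such that Θ_n converges to Θ in the following sense: for every g : [0,∞) × U → ℝ such that g(t,·) is continuous on U for each t and t ↦ sup_{u∈U} |g(t,u)| is Lebesgue integrable, one has ∫_0^∞ ∫_U g(t,u) μ_n(t,du) dt → ∫_0^∞ ∫_U g(t,u) μ(t,du) dt, and μ_{∂,n} → μ_∂ weakly. Then: (a) lim_{n} 𝓛_{α_n}(x,Θ_n) = 𝓛_α(x,Θ); (b) liminf_{n} L_{α_n} f(x,Θ_n) ≥ L_α f(x,Θ); (c) liminf_{n} H_{α_n} r(x,Θ_n) ≥ H_α r(x,Θ); (d) liminf_{n} G_{α_n} h_{α_n}(x,Θ_n)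 ≥ G_α h(x,Θ). (Proposition 5.1 of the paper.) -/
open MeasureTheory ProbabilityTheory Set Filter Topology
open scoped ENNReal NNReal

noncomputable section

abbrev Rn (n : ℕ) : Type := EuclideanSpace ℝ (Fin n)

variable {n : ℕ} {U : Type*}

/-- The boundary hitting time of the flow, `inf {t > 0 : φ(x,t) ∈ ∂E}`, with `inf ∅ = ∞`. -/
def tstar (E : Set (Rn n)) (φ : Rn n → ℝ → Rn n) (x : Rn n) : ℝ≥0∞ :=
  ⨅ t ∈ {t : ℝ | 0 < t ∧ φ x t ∈ frontier E}, ENNReal.ofReal t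

/-- The interval `[0, t_*(x))` viewed as a subset of `ℝ`. -/
def domSet (E : Set (Rn n)) (φ : Rn n → ℝ → Rn n) (x : Rn n) : Set ℝ :=
  {s : ℝ | 0 ≤ s ∧ ENNReal.ofReal s < tstar E φ x}

/-- `φ(x, t_*(x))`, equal to the distinguished boundary point `Δ` when `t_*(x) = ∞`. -/
def flowBd (E : Set (Rn n)) (φ : Rn n → ℝ → Rn n) (Δ : Rn n) (x : Rn n) : Rn n :=
  if tstar E φ x ≠ ⊤ then φ x (tstar E φ x).toReal else Δ

/-- `w ∈ M^{ac}(E)` : Borel measurable on `E`, absolutely continuous along the flow on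
`[0,t_*(x))` (encoded via the existence of a locally integrable a.e. derivative), with a limit
towards the boundary whenever `t_*(x) < ∞`. -/
def MemMac (E : Set (Rn n)) (φ : Rn n → ℝ → Rn n) (w : Rn n → ℝ) : Prop :=
  Measurable (fun x : E => w x.1) ∧
  (∀ x ∈ E, ∃ d : ℝ → ℝ, ∀ t : ℝ, 0 ≤ t → ENNReal.ofReal t < tstar E φ x →
      IntervalIntegrable d volume 0 t ∧ w (φ x t) = w x + ∫ s in (0:ℝ)..t, d s) ∧
  (∀ x ∈ E, tstar E φ x ≠ ⊤ →
      ∃ L : ℝ, Tendsto (fun t => w (φ x t))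
        (nhdsWithin (tstar E φ x).toReal (Set.Iio (tstar E φ x).toReal)) (nhds L))

section Ops

variable [MeasurableSpace U]

/-- `Qh(y,a) = ∫_E h(z) Q(y,a;dz)`. -/
def Qh (Q : Kernel (Rn n × U) (Rn n)) (h : Rn n → ℝ) (y : Rn n) (a : U) : ℝ :=
  ∫ z, h z ∂(Q (y, a))

/-- Integrated jump rate along the flow, ordinary control. -/
def oLam (φ : Rn n → ℝ → Rn n) (lam : Rn n → U → ℝ) (x : Rn n) (ν : ℝ → U) (t : ℝ) : ℝ :=
  ∫ s in (0:ℝ)..t, lam (φ x s) (ν s)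

def oE (φ : Rn n → ℝ → Rn n) (lam : Rn n → U → ℝ) (α : ℝ) (x : Rn n) (ν : ℝ → U) (t : ℝ) : ℝ :=
  Real.exp (-(α * t) - oLam φ lam x ν t)

/-- `e^{-α t_*(x) - Λ^ν(x,t_*(x))}`, interpreted as the limit (= infimum, by monotonicity)
when `t_*(x) = ∞`. -/
def oSurv (E : Set (Rn n)) (φ : Rn n → ℝ → Rn n) (lam : Rn n → U → ℝ) (α : ℝ)
    (x : Rn n) (ν : ℝ → U) : ℝ :=
  if tstar E φ x ≠ ⊤ then oE φ lam α x ν (tstar E φ x).toReal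
  else sInf (oE φ lam α x ν '' Set.Ici 0)

def oL (E : Set (Rn n)) (φ : Rn n → ℝ → Rn n) (lam : Rn n → U → ℝ) (α : ℝ)
    (x : Rn n) (ν : ℝ → U) : ℝ :=
  ∫ s in domSet E φ x, oE φ lam α x ν s

def oLf (E : Set (Rn n)) (φ : Rn n → ℝ → Rn n) (lam f : Rn n → U → ℝ) (α : ℝ)
    (x : Rn n) (ν : ℝ → U) : ℝ :=
  ∫ s in domSet E φ x, oE φ lam α x ν s * f (φ x s) (ν s)

def oH (E : Set (Rn n)) (φ : Rn n → ℝ → Rn n) (Δ : Rn n) (lam r : Rn n → U → ℝ) (α : ℝ)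
    (x : Rn n) (ν : ℝ → U) (νb : U) : ℝ :=
  oSurv E φ lam α x ν * r (flowBd E φ Δ x) νb

def oG (E : Set (Rn n)) (φ : Rn n → ℝ → Rn n) (Δ : Rn n) (lam : Rn n → U → ℝ)
    (Q : Kernel (Rn n × U) (Rn n)) (h : Rn n → ℝ) (α : ℝ)
    (x : Rn n) (ν : ℝ → U) (νb : U) : ℝ :=
  (∫ s in domSet E φ x, oE φ lam α x ν s * (lam (φ x s) (ν s) * Qh Q h (φ x s) (ν s)))
    + oSurv E φ lam α x ν * Qh Q h (flowBd E φ Δ x) νb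

/-- The set `𝕍(x)` of ordinary (open-loop) controls feasible at `x`. -/
def OrdSet (E : Set (Rn n)) (φ : Rn n → ℝ → Rn n) (Δ : Rn n) (Uc : Rn n → Set U)
    (x : Rn n) : Set ((ℝ → U) × U) :=
  {Υ | Measurable Υ.1 ∧ (∀ t : ℝ, 0 ≤ t → Υ.1 t ∈ Uc (φ x t)) ∧ Υ.2 ∈ Uc (flowBd E φ Δ x)}

def oVal (E : Set (Rn n)) (φ : Rn n → ℝ → Rn n) (Δ : Rn n) (lam f r : Rn n → U → ℝ)
    (Q : Kernel (Rn n × U) (Rn n)) (α ρ : ℝ) (h : Rn n → ℝ) (x : Rn n)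
    (Υ : (ℝ → U) × U) : ℝ :=
  -ρ * oL E φ lam α x Υ.1 + oLf E φ lam f α x Υ.1 + oH E φ Δ lam r α x Υ.1 Υ.2
    + oG E φ Δ lam Q h α x Υ.1 Υ.2

/-- The ordinary one-stage optimization operator `𝒯_α(ρ,h)(x)`. -/
def Tcal (E : Set (Rn n)) (φ : Rn n → ℝ → Rn n) (Δ : Rn n) (Uc : Rn n → Set U)
    (lam f r : Rn n → U → ℝ) (Q : Kernel (Rn n × U) (Rn n)) (α ρ : ℝ) (h : Rn n → ℝ)
    (x : Rn n) : ℝ :=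
  sInf (oVal E φ Δ lam f r Q α ρ h x '' OrdSet E φ Δ Uc x)

/-- Integrated jump rate along the flow, relaxed control. -/
def rLam (φ : Rn n → ℝ → Rn n) (lam : Rn n → U → ℝ) (x : Rn n)
    (μ : ℝ → Measure U) (t : ℝ) : ℝ :=
  ∫ s in (0:ℝ)..t, ∫ u, lam (φ x s) u ∂(μ s)

def rE (φ : Rn n → ℝ → Rn n) (lam : Rn n → U → ℝ) (α : ℝ) (x : Rn n)
    (μ : ℝ → Measure U) (t : ℝ) : ℝ :=
  Real.exp (-(α * t) - rLam φ lam x μ t)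

def rSurv (E : Set (Rn n)) (φ : Rn n → ℝ → Rn n) (lam : Rn n → U → ℝ) (α : ℝ)
    (x : Rn n) (μ : ℝ → Measure U) : ℝ :=
  if tstar E φ x ≠ ⊤ then rE φ lam α x μ (tstar E φ x).toReal
  else sInf (rE φ lam α x μ '' Set.Ici 0)

def rL (E : Set (Rn n)) (φ : Rn n → ℝ → Rn n) (lam : Rn n → U → ℝ) (α : ℝ)
    (x : Rn n) (μ : ℝ → Measure U) : ℝ :=
  ∫ s in domSet E φ x, rE φ lam α x μ s

def rLf (E : Set (Rn n)) (φ : Rn n → ℝ → Rn n) (lam f : Rn n → U → ℝ) (α : ℝ)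
    (x : Rn n) (μ : ℝ → Measure U) : ℝ :=
  ∫ s in domSet E φ x, rE φ lam α x μ s * ∫ u, f (φ x s) u ∂(μ s)

def rH (E : Set (Rn n)) (φ : Rn n → ℝ → Rn n) (Δ : Rn n) (lam r : Rn n → U → ℝ) (α : ℝ)
    (x : Rn n) (μ : ℝ → Measure U) (μb : Measure U) : ℝ :=
  rSurv E φ lam α x μ * ∫ u, r (flowBd E φ Δ x) u ∂μb

def rG (E : Set (Rn n)) (φ : Rn n → ℝ → Rn n) (Δ : Rn n) (lam : Rn n → U → ℝ)
    (Q : Kernel (Rn n × U) (Rn n)) (h : Rn n → ℝ) (α : ℝ)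
    (x : Rn n) (μ : ℝ → Measure U) (μb : Measure U) : ℝ :=
  (∫ s in domSet E φ x, rE φ lam α x μ s * ∫ u, lam (φ x s) u * Qh Q h (φ x s) u ∂(μ s))
    + rSurv E φ lam α x μ * ∫ u, Qh Q h (flowBd E φ Δ x) u ∂μb

/-- The set `𝕍^r(x)` of relaxed controls feasible at `x`. -/
def RelSet (E : Set (Rn n)) (φ : Rn n → ℝ → Rn n) (Δ : Rn n) (Uc : Rn n → Set U)
    (x : Rn n) : Set ((ℝ → Measure U) × Measure U) :=
  {Θ | Measurable Θ.1 ∧ (∀ t : ℝ, IsProbabilityMeasure (Θ.1 t)) ∧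
    (∀ᵐ t ∂(volume.restrict (Set.Ici (0:ℝ))), Θ.1 t (Uc (φ x t)) = 1) ∧
    IsProbabilityMeasure Θ.2 ∧ Θ.2 (Uc (flowBd E φ Δ x)) = 1}

def rVal (E : Set (Rn n)) (φ : Rn n → ℝ → Rn n) (Δ : Rn n) (lam f r : Rn n → U → ℝ)
    (Q : Kernel (Rn n × U) (Rn n)) (α ρ : ℝ) (h : Rn n → ℝ) (x : Rn n)
    (Θ : (ℝ → Measure U) × Measure U) : ℝ :=
  -ρ * rL E φ lam α x Θ.1 + rLf E φ lam f α x Θ.1 + rH E φ Δ lam r α x Θ.1 Θ.2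
    + rG E φ Δ lam Q h α x Θ.1 Θ.2

/-- The relaxed one-stage optimization operator `ℛ_α(ρ,h)(x)`. -/
def Rcal (E : Set (Rn n)) (φ : Rn n → ℝ → Rn n) (Δ : Rn n) (Uc : Rn n → Set U)
    (lam f r : Rn n → U → ℝ) (Q : Kernel (Rn n × U) (Rn n)) (α ρ : ℝ) (h : Rn n → ℝ)
    (x : Rn n) : ℝ :=
  sInf (rVal E φ Δ lam f r Q α ρ h x '' RelSet E φ Δ Uc x)

/-- `𝓛_α(x,Θ)` with values in `[0,∞]`. -/
def nL (E : Set (Rn n)) (φ : Rn n → ℝ → Rn n) (lam : Rn n → U → ℝ) (α : ℝ)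
    (x : Rn n) (μ : ℝ → Measure U) : ℝ≥0∞ :=
  ∫⁻ s in domSet E φ x, ENNReal.ofReal (rE φ lam α x μ s)

/-- `L_α f(x,Θ)` with values in `[0,∞]`. -/
def nLf (E : Set (Rn n)) (φ : Rn n → ℝ → Rn n) (lam f : Rn n → U → ℝ) (α : ℝ)
    (x : Rn n) (μ : ℝ → Measure U) : ℝ≥0∞ :=
  ∫⁻ s in domSet E φ x,
    ENNReal.ofReal (rE φ lam α x μ s) * ∫⁻ u, ENNReal.ofReal (f (φ x s) u) ∂(μ s)

/-- `H_α r(x,Θ)` with values in `[0,∞]`. -/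
def nH (E : Set (Rn n)) (φ : Rn n → ℝ → Rn n) (Δ : Rn n) (lam r : Rn n → U → ℝ) (α : ℝ)
    (x : Rn n) (μ : ℝ → Measure U) (μb : Measure U) : ℝ≥0∞ :=
  ENNReal.ofReal (rSurv E φ lam α x μ) * ∫⁻ u, ENNReal.ofReal (r (flowBd E φ Δ x) u) ∂μb

/-- `∫_E (h(z)+K) Q(y,a;dz) ∈ [0,∞]`, for `h` bounded below by `-K` on `E`. -/
def nQp (Q : Kernel (Rn n × U) (Rn n)) (h : Rn n → ℝ) (Kb : ℝ) (y : Rn n) (a : U) : ℝ≥0∞ :=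
  ∫⁻ z, ENNReal.ofReal (h z + Kb) ∂(Q (y, a))

def nGp (E : Set (Rn n)) (φ : Rn n → ℝ → Rn n) (Δ : Rn n) (lam : Rn n → U → ℝ)
    (Q : Kernel (Rn n × U) (Rn n)) (h : Rn n → ℝ) (Kb : ℝ) (α : ℝ)
    (x : Rn n) (μ : ℝ → Measure U) (μb : Measure U) : ℝ≥0∞ :=
  (∫⁻ s in domSet E φ x, ENNReal.ofReal (rE φ lam α x μ s) *
      ∫⁻ u, ENNReal.ofReal (lam (φ x s) u) * nQp Q h Kb (φ x s) u ∂(μ s))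
    + ENNReal.ofReal (rSurv E φ lam α x μ) * ∫⁻ u, nQp Q h Kb (flowBd E φ Δ x) u ∂μb

/-- `∫_0^{t_*} e^{-αs-Λ} λ ds + e^{-α t_* - Λ(t_*)} ∈ [0,∞]` (always finite in fact). -/
def nLamTot (E : Set (Rn n)) (φ : Rn n → ℝ → Rn n) (lam : Rn n → U → ℝ) (α : ℝ)
    (x : Rn n) (μ : ℝ → Measure U) : ℝ≥0∞ :=
  (∫⁻ s in domSet E φ x, ENNReal.ofReal (rE φ lam α x μ s) *
      ∫⁻ u, ENNReal.ofReal (lam (φ x s) u) ∂(μ s))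
    + ENNReal.ofReal (rSurv E φ lam α x μ)

/-- `G_α h(x,Θ)` with values in `(−∞,∞]`, for `h` bounded below by `-Kb` on `E`:
`G_α h = G_α (h + Kb) − Kb (∫_0^{t_*} e^{-αs-Λ}λ ds + e^{-αt_*-Λ(t_*)})`. -/
def eG (E : Set (Rn n)) (φ : Rn n → ℝ → Rn n) (Δ : Rn n) (lam : Rn n → U → ℝ)
    (Q : Kernel (Rn n × U) (Rn n)) (h : Rn n → ℝ) (Kb : ℝ) (α : ℝ)
    (x : Rn n) (μ : ℝ → Measure U) (μb : Measure U) : EReal :=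
  (nGp E φ Δ lam Q h Kb α x μ μb : EReal) - (Kb : EReal) * (nLamTot E φ lam α x μ : EReal)

end Ops

section LowerSemicontinuity

variable {S : Type*} [MeasurableSpace S]

theorem le_essInf_iff_measure_lt_eq_zero {Y : Type*} [MeasurableSpace Y] {m : Measure Y}
    {g : Y → ℝ≥0∞} {c : ℝ≥0∞} : c ≤ essInf g m ↔ m {v | g v < c} = 0 := by
  constructor
  · intro h
    have h1 : ∀ᵐ v ∂m, c ≤ g v := by
      filter_upwards [ae_essInf_le (f := g) (μ := m)] with v hv using h.trans hv
    simpa [ae_iff] using h1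
  · intro h
    refine le_essInf_of_ae_le c ?_
    change ∀ᵐ v ∂m, c ≤ g v
    simpa [ae_iff] using h

theorem essSup_le_iff_measure_lt_eq_zero {Y : Type*} [MeasurableSpace Y] {m : Measure Y}
    {g : Y → ℝ≥0∞} {c : ℝ≥0∞} : essSup g m ≤ c ↔ m {v | c < g v} = 0 := by
  constructor
  · intro h
    have h1 : ∀ᵐ v ∂m, g v ≤ c := by
      filter_upwards [ENNReal.ae_le_essSup (μ := m) g] with v hv using hv.trans h
    simpa [ae_iff] using h1
  · intro h
    refine essSup_le_of_ae_le c ?_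
    change ∀ᵐ v ∂m, g v ≤ c
    simpa [ae_iff] using h

theorem measurable_essInf_kernel {Y : Type*} [MeasurableSpace Y] (κ : Kernel S Y)
    [IsSFiniteKernel κ] {g : S → Y → ℝ≥0∞} (hg : Measurable (Function.uncurry g)) :
    Measurable fun s => essInf (g s) (κ s) := by
  refine measurable_of_Ici fun c => ?_
  have h : (fun s => essInf (g s) (κ s)) ⁻¹' Ici c
      = (fun s => κ s (Prod.mk s ⁻¹' {p | Function.uncurry g p < c})) ⁻¹' {0} := by
    ext s
    exact le_essInf_iff_measure_lt_eq_zero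
  rw [h]
  exact Kernel.measurable_kernel_prodMk_left (hg measurableSet_Iio) (measurableSet_singleton 0)

theorem measurable_essSup_kernel {Y : Type*} [MeasurableSpace Y] (κ : Kernel S Y)
    [IsSFiniteKernel κ] {g : S → Y → ℝ≥0∞} (hg : Measurable (Function.uncurry g)) :
    Measurable fun s => essSup (g s) (κ s) := by
  refine measurable_of_Iic fun c => ?_
  have h : (fun s => essSup (g s) (κ s)) ⁻¹' Iic c
      = (fun s => κ s (Prod.mk s ⁻¹' {p | c < Function.uncurry g p})) ⁻¹' {0} := by
    ext s
    exact essSup_le_iff_measure_lt_eq_zero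
  rw [h]
  exact Kernel.measurable_kernel_prodMk_left (hg measurableSet_Ioi) (measurableSet_singleton 0)

theorem lintegral_lintegral_le_mul {Y : Type*} [MeasurableSpace Y] {ν : Measure S}
    (κ : Kernel S Y) [IsMarkovKernel κ] {g : S → Y → ℝ≥0∞} {C : ℝ≥0∞}
    {A : Set S} (hA : MeasurableSet A)
    (hg : ∀ s u, g s u ≤ A.indicator (fun _ => C) s) :
    ∫⁻ s, ∫⁻ u, g s u ∂(κ s) ∂ν ≤ C * ν A := by
  calc ∫⁻ s, ∫⁻ u, g s u ∂(κ s) ∂ν ≤ ∫⁻ s, A.indicator (fun _ => C) s ∂ν := by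
        refine lintegral_mono fun s => ?_
        calc ∫⁻ u, g s u ∂(κ s) ≤ ∫⁻ _, A.indicator (fun _ => C) s ∂(κ s) :=
              lintegral_mono fun u => hg s u
          _ = A.indicator (fun _ => C) s := by simp
    _ = C * ν A := by rw [lintegral_indicator hA]; simp

theorem integral_integral_toReal {Y : Type*} [MeasurableSpace Y] {ν : Measure S}
    (κ : Kernel S Y) [IsMarkovKernel κ] {g : S → Y → ℝ≥0∞}
    (hgm : Measurable (Function.uncurry g)) (hg : ∀ s u, g s u ≠ ⊤)
    (hfin : ∀ᵐ s ∂ν, ∫⁻ u, g s u ∂(κ s) < ⊤) :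
    ∫ s, ∫ u, (g s u).toReal ∂(κ s) ∂ν = (∫⁻ s, ∫⁻ u, g s u ∂(κ s) ∂ν).toReal := by
  rw [← integral_toReal (Measurable.lintegral_kernel_prod_right hgm).aemeasurable hfin]
  congr 1
  ext s
  exact integral_toReal (hgm.comp measurable_prodMk_left).aemeasurable
    (Eventually.of_forall fun u => (hg s u).lt_top)

theorem kernel_le_add_sum {Y : Type*} [MeasurableSpace Y] (κ : ℕ → Kernel S Y) (η : Kernel S Y)
    (s : S) : η s ≤ (η + Kernel.sum κ) s := by
  rw [_root_.add_apply]
  exact Measure.le_add_right le_rfl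

theorem kernel_le_add_sum' {Y : Type*} [MeasurableSpace Y] (κ : ℕ → Kernel S Y) (η : Kernel S Y)
    (k : ℕ) (s : S) : κ k s ≤ (η + Kernel.sum κ) s := by
  rw [_root_.add_apply, Kernel.sum_apply]
  exact Measure.le_add_left (Measure.le_sum (fun k => κ k s) k)

/-- Two sequences with constant finite sum whose limits inferior are at least `a` and `b`, where
`a + b` is the constant, converge. -/
theorem tendsto_of_le_liminf_of_add_eq {x y : ℕ → ℝ≥0∞} {a b c : ℝ≥0∞} (hc : c ≠ ⊤)
    (hxy : ∀ k, x k + y k = c) (hab : a + b = c) (hx : a ≤ liminf x atTop)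
    (hy : b ≤ liminf y atTop) : Tendsto x atTop (𝓝 a) := by
  have hbt : b ≠ ⊤ := fun hb => hc (by rw [← hab, hb, add_top])
  refine tendsto_of_le_liminf_of_limsup_le hx ?_
  have hx' : x = fun k => c - y k := by
    ext k
    exact ENNReal.eq_sub_of_add_eq (fun hk => hc (by rw [← hxy k, hk, add_top])) (hxy k)
  rw [hx', ENNReal.limsup_const_sub _ _ hc, ← hab]
  refine (tsub_le_tsub_left hy _).trans ?_
  simp [hbt]

variable [MetricSpace U] [MeasurableSpace U]

/-- Convergence of relaxed controls: convergence of the integrals of all bounded Carathéodory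
functions that vanish outside a set of finite measure in the first variable. -/
def RelaxedTendsto (ν : Measure S) (κ : ℕ → Kernel S U) (η : Kernel S U) : Prop :=
  ∀ g : S → U → ℝ, Measurable (Function.uncurry g) → (∀ s, Continuous (g s)) →
    (∃ (C : ℝ) (A : Set S), MeasurableSet A ∧ ν A < ⊤ ∧
      ∀ s u, |g s u| ≤ A.indicator (fun _ => C) s) →
    Tendsto (fun k => ∫ s, ∫ u, g s u ∂(κ k s) ∂ν) atTop (𝓝 (∫ s, ∫ u, g s u ∂(η s) ∂ν))

theorem RelaxedTendsto.tendsto_lintegral {ν : Measure S} {κ : ℕ → Kernel S U} {η : Kernel S U}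
    [∀ k, IsMarkovKernel (κ k)] [IsMarkovKernel η] (h : RelaxedTendsto ν κ η)
    {g : S → U → ℝ≥0∞} (hgm : Measurable (Function.uncurry g)) (hgc : ∀ s, Continuous (g s))
    {C : ℝ≥0∞} (hC : C ≠ ⊤) {A : Set S} (hA : MeasurableSet A) (hνA : ν A < ⊤)
    (hg : ∀ s u, g s u ≤ A.indicator (fun _ => C) s) :
    Tendsto (fun k => ∫⁻ s, ∫⁻ u, g s u ∂(κ k s) ∂ν) atTop
      (𝓝 (∫⁻ s, ∫⁻ u, g s u ∂(η s) ∂ν)) := by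
  have hind : ∀ s, A.indicator (fun _ => C) s ≠ ⊤ := fun s => by
    by_cases hs : s ∈ A <;> simp [hs, hC]
  have hgtop : ∀ s u, g s u ≠ ⊤ := fun s u => ((hg s u).trans_lt (hind s).lt_top).ne
  have hfin : ∀ (κ : Kernel S U) [IsMarkovKernel κ], ∀ᵐ s ∂ν, ∫⁻ u, g s u ∂(κ s) < ⊤ := by
    intro κ _
    refine Eventually.of_forall fun s => ?_
    refine (lintegral_mono fun u => hg s u).trans_lt ?_
    simpa using (hind s).lt_top
  have hlt : ∀ (κ : Kernel S U) [IsMarkovKernel κ], ∫⁻ s, ∫⁻ u, g s u ∂(κ s) ∂ν ≠ ⊤ :=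
    fun κ _ => ((lintegral_lintegral_le_mul κ hA hg).trans_lt
      (ENNReal.mul_lt_top hC.lt_top hνA)).ne
  rw [← ENNReal.tendsto_toReal_iff (fun k => hlt (κ k)) (hlt η)]
  simp_rw [← integral_integral_toReal _ hgm hgtop (hfin _)]
  refine h _ hgm.ennreal_toReal (fun s => ?_) ⟨C.toReal, A, hA, hνA, fun s u => ?_⟩
  · exact ENNReal.continuousOn_toReal.comp_continuous (hgc s) fun u => hgtop s u
  · rw [abs_of_nonneg ENNReal.toReal_nonneg]
    refine (ENNReal.toReal_mono (hind s) (hg s u)).trans_eq ?_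
    by_cases hs : s ∈ A <;> simp [hs]

/-- The `k`-th essential Lipschitz regularization (inf-convolution with `k · d`) of `f` with
respect to the measure `m`. -/
def lipEnv (m : Measure U) (f : U → ℝ≥0∞) (k : ℕ) (u : U) : ℝ≥0∞ :=
  essInf (fun v => min (f v) k + k * edist u v) m

theorem lipEnv_mono (m : Measure U) (f : U → ℝ≥0∞) (u : U) :
    Monotone fun k => lipEnv m f k u := by
  intro k l hkl
  have : (k : ℝ≥0∞) ≤ l := by exact_mod_cast hkl
  exact essInf_mono_ae (Eventually.of_forall fun v => by dsimp only; gcongr)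

theorem lipEnv_le_add (m : Measure U) (f : U → ℝ≥0∞) (k : ℕ) (u w : U) :
    lipEnv m f k u ≤ lipEnv m f k w + k * edist u w := by
  rw [← tsub_le_iff_right]
  refine le_essInf_of_ae_le _ ?_
  filter_upwards [ae_essInf_le (f := fun v => min (f v) k + k * edist u v) (μ := m)] with v hv
  rw [tsub_le_iff_right]
  refine hv.trans ?_
  calc min (f v) k + k * edist u v ≤ min (f v) k + k * (edist u w + edist w v) := by
        gcongr; exact edist_triangle _ _ _
    _ = min (f v) k + k * edist w v + k * edist u w := by ring

theorem continuous_lipEnv (m : Measure U) (f : U → ℝ≥0∞) (k : ℕ) :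
    Continuous (lipEnv m f k) := by
  refine continuous_of_le_add_edist (k : ℝ≥0∞) (by simp) fun u w => ?_
  exact lipEnv_le_add m f k u w

theorem lipEnv_le_bound (m : Measure U) [NeZero m] (f : U → ℝ≥0∞) (k : ℕ) (u : U) :
    lipEnv m f k u ≤ k + k * Metric.ediam (univ : Set U) := by
  rw [← essInf_const' (μ := m) ((k : ℝ≥0∞) + k * Metric.ediam (univ : Set U))]
  refine essInf_mono_ae (Eventually.of_forall fun v => ?_)
  have := Metric.edist_le_ediam_of_mem (mem_univ u) (mem_univ v)
  dsimp only
  gcongr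
  exact min_le_right _ _

theorem le_iSup_lipEnv {m : Measure U} {f : U → ℝ≥0∞} {K : Set U} (hK : ∀ᵐ u ∂m, u ∈ K)
    (hf : ContinuousOn f K) {u : U} (hu : u ∈ K) : f u ≤ ⨆ k, lipEnv m f k u := by
  refine le_of_forall_lt fun c hc => ?_
  obtain ⟨b, hcb, hb⟩ := exists_between hc
  have hev := (hf u hu).eventually (lt_mem_nhds hb)
  rw [eventually_nhdsWithin_iff, Metric.nhds_basis_eball.eventually_iff] at hev
  obtain ⟨δ, hδ, hball⟩ := hev
  have hbtop : b ≠ ⊤ := (hb.trans_le le_top).ne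
  obtain ⟨k, hk⟩ := ENNReal.exists_nat_mul_gt hδ.ne' hbtop
  obtain ⟨l, hl⟩ := ENNReal.exists_nat_gt hbtop
  refine hcb.trans_le (le_iSup_of_le (max k l) ?_)
  refine le_essInf_of_ae_le _ ?_
  filter_upwards [hK] with v hv
  have hkl : (k : ℝ≥0∞) ≤ (max k l : ℕ) := by exact_mod_cast le_max_left k l
  have hll : (l : ℝ≥0∞) ≤ (max k l : ℕ) := by exact_mod_cast le_max_right k l
  by_cases hvb : v ∈ Metric.eball u δ
  · exact le_add_right (le_min (hball hvb hv).le (hl.le.trans hll))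
  · have : δ ≤ edist u v := by
      rw [edist_comm]; simpa [Metric.mem_eball] using hvb
    refine le_add_left (hk.le.trans ?_)
    gcongr

variable [CompactSpace U]

theorem ae_lipEnv_le {m : Measure U} {f : U → ℝ≥0∞} {K : Set U} (hK : ∀ᵐ u ∂m, u ∈ K)
    (hf : ContinuousOn f K) : ∀ᵐ u ∂m, ∀ k, lipEnv m f k u ≤ f u := by
  filter_upwards [hK, Measure.support_mem_ae (μ := m)] with u huK hus k
  by_contra! hlt
  have hcont : ContinuousWithinAt (fun v => min (f v) k + k * edist u v) K u := by
    refine ContinuousWithinAt.add ((hf u huK).min continuousWithinAt_const) ?_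
    exact ((ENNReal.continuous_const_mul (ENNReal.natCast_ne_top k)).comp
      (continuous_const.edist continuous_id)).continuousWithinAt
  have hlt' : min (f u) k + k * edist u u < lipEnv m f k u := by
    simpa using Or.inl hlt
  have hev := hcont.eventually (gt_mem_nhds hlt')
  rw [eventually_nhdsWithin_iff] at hev
  have hpos := (Measure.mem_support_iff_forall u).1 hus _ hev
  refine hpos.ne' ?_
  have := ae_essInf_le (f := fun v => min (f v) k + k * edist u v) (μ := m)
  have h2 : ∀ᵐ v ∂m, ¬ (v ∈ K → min (f v) k + k * edist u v < lipEnv m f k u) := by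
    filter_upwards [this, hK] with v hv hvK hcon
    exact absurd (hcon hvK) (not_lt.2 hv)
  simpa [ae_iff] using h2

variable [BorelSpace U]

theorem measurable_lipEnv (κ : Kernel S U) [IsSFiniteKernel κ] {f : S → U → ℝ≥0∞}
    (hf : Measurable (Function.uncurry f)) (k : ℕ) :
    Measurable (Function.uncurry fun s => lipEnv (κ s) (f s) k) := by
  have h := measurable_essInf_kernel (κ.comap (Prod.fst : S × U → S) measurable_fst)
    (g := fun p v => min (f p.1 v) k + k * edist p.2 v) (by
      have h1 : Measurable fun q : (S × U) × U => f q.1.1 q.2 :=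
        hf.comp (measurable_fst.fst.prodMk measurable_snd)
      have h2 : Measurable fun q : (S × U) × U => edist q.1.2 q.2 :=
        measurable_fst.snd.edist measurable_snd
      exact (h1.min measurable_const).add (h2.const_mul _))
  exact h

variable {ν : Measure S} {κ : ℕ → Kernel S U} {η : Kernel S U}
  [∀ k, IsMarkovKernel (κ k)] [IsMarkovKernel η]

/-- If `f` is continuous on sets carrying all the controls, the integral of `f` is lower
semicontinuous along the convergence of relaxed controls. -/
theorem RelaxedTendsto.lintegral_le_liminf [SigmaFinite ν] (h : RelaxedTendsto ν κ η)
    {K : S → Set U} (hK : ∀ᵐ s ∂ν, ∀ᵐ u ∂((η + Kernel.sum κ) s), u ∈ K s)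
    {f : S → U → ℝ≥0∞} (hfm : Measurable (Function.uncurry f))
    (hfc : ∀ᵐ s ∂ν, ContinuousOn (f s) (K s)) :
    ∫⁻ s, ∫⁻ u, f s u ∂(η s) ∂ν ≤ liminf (fun k => ∫⁻ s, ∫⁻ u, f s u ∂(κ k s) ∂ν) atTop := by
  set m : Kernel S U := η + Kernel.sum κ
  have hη : ∀ s, η s ≤ m s := kernel_le_add_sum κ η
  have hκ : ∀ k s, κ k s ≤ m s := kernel_le_add_sum' κ η
  have hmz : ∀ s, NeZero (m s) := fun s => ⟨fun h0 => by
    have := hη s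
    rw [h0] at this
    exact IsProbabilityMeasure.ne_zero (η s) (le_antisymm this (Measure.zero_le _))⟩
  let A : ℕ → Set S := spanningSets ν
  let g : ℕ → S → U → ℝ≥0∞ := fun N s u => (A N).indicator 1 s * lipEnv (m s) (f s) N u
  have hAm : ∀ N, MeasurableSet (A N) := measurableSet_spanningSets ν
  have hgm : ∀ N, Measurable (Function.uncurry (g N)) := fun N =>
    ((measurable_one.indicator (hAm N)).comp measurable_fst).mul (measurable_lipEnv m hfm N)
  have hgmono : ∀ s u, Monotone fun N => g N s u := by
    intro s u N M hNM
    refine mul_le_mul' ?_ (lipEnv_mono (m s) (f s) u hNM)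
    exact indicator_le_indicator_of_subset (monotone_spanningSets ν hNM) (fun _ => zero_le) s
  have hle : ∀ᵐ s ∂ν, ∀ᵐ u ∂(m s), ∀ N, g N s u ≤ f s u := by
    filter_upwards [hK, hfc] with s hs hc
    filter_upwards [ae_lipEnv_le hs hc] with u hu N
    refine (mul_le_of_le_one_left zero_le ?_).trans (hu N)
    exact indicator_le (fun _ _ => le_rfl) s
  have hge : ∀ᵐ s ∂ν, ∀ᵐ u ∂(m s), f s u ≤ ⨆ N, g N s u := by
    filter_upwards [hK, hfc] with s hs hc
    filter_upwards [hs] with u hu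
    refine (le_iSup_lipEnv hs hc hu).trans (iSup_le fun N => ?_)
    obtain ⟨M, hM⟩ : ∃ M, s ∈ A M := by
      have : s ∈ ⋃ M, A M := by simp [A, iUnion_spanningSets]
      simpa using this
    refine le_iSup_of_le (max M N) ?_
    have hsM : s ∈ A (max M N) := monotone_spanningSets ν (le_max_left M N) hM
    simp only [g, indicator_of_mem hsM, Pi.one_apply, one_mul]
    exact lipEnv_mono (m s) (f s) u (le_max_right M N)
  have hlim : ∀ N, Tendsto (fun k => ∫⁻ s, ∫⁻ u, g N s u ∂(κ k s) ∂ν) atTop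
      (𝓝 (∫⁻ s, ∫⁻ u, g N s u ∂(η s) ∂ν)) := by
    intro N
    refine h.tendsto_lintegral (hgm N) (fun s => ?_)
      (C := N + N * Metric.ediam (univ : Set U)) ?_ (hAm N) (measure_spanningSets_lt_top ν N) ?_
    · refine (ENNReal.continuous_const_mul ?_).comp (continuous_lipEnv (m s) (f s) N)
      by_cases hs : s ∈ A N <;> simp [hs]
    · have : Metric.ediam (univ : Set U) ≠ ⊤ := isCompact_univ.isBounded.ediam_ne_top
      finiteness
    · intro s u
      by_cases hs : s ∈ A N
      · simpa [g, hs] using lipEnv_le_bound (m s) (f s) N u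
      · simp [g, hs]
  calc ∫⁻ s, ∫⁻ u, f s u ∂(η s) ∂ν ≤ ∫⁻ s, ∫⁻ u, ⨆ N, g N s u ∂(η s) ∂ν := by
        refine lintegral_mono_ae ?_
        filter_upwards [hge] with s hs
        exact lintegral_mono_ae (ae_mono (hη s) hs)
    _ = ∫⁻ s, ⨆ N, ∫⁻ u, g N s u ∂(η s) ∂ν := by
        congr 1
        ext s
        exact lintegral_iSup (fun N => (hgm N).comp measurable_prodMk_left)
          fun N M hNM u => hgmono s u hNM
    _ = ⨆ N, ∫⁻ s, ∫⁻ u, g N s u ∂(η s) ∂ν := by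
        refine lintegral_iSup (fun N => Measurable.lintegral_kernel_prod_right (hgm N)) ?_
        exact fun N M hNM s => lintegral_mono fun u => hgmono s u hNM
    _ ≤ liminf (fun k => ∫⁻ s, ∫⁻ u, f s u ∂(κ k s) ∂ν) atTop := by
        refine iSup_le fun N => ?_
        rw [← (hlim N).liminf_eq]
        refine liminf_le_liminf (Eventually.of_forall fun k => lintegral_mono_ae ?_)
        filter_upwards [hle] with s hs
        refine lintegral_mono_ae ?_
        filter_upwards [ae_mono (hκ k s) hs] with u hu using hu N

/-- Lower semicontinuity for a varying integrand `F k` which eventually dominates each member of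
an increasing sequence of integrands that are continuous on sets carrying all the controls. -/
theorem RelaxedTendsto.lintegral_le_liminf_of_approx [SigmaFinite ν] (h : RelaxedTendsto ν κ η)
    {K : S → Set U} (hK : ∀ᵐ s ∂ν, ∀ᵐ u ∂((η + Kernel.sum κ) s), u ∈ K s)
    {G : ℕ → S → U → ℝ≥0∞} (hGm : ∀ N, Measurable (Function.uncurry (G N)))
    (hGc : ∀ N, ∀ᵐ s ∂ν, ContinuousOn (G N s) (K s)) (hGmono : ∀ s u, Monotone fun N => G N s u)
    {f : S → U → ℝ≥0∞} {F : ℕ → S → U → ℝ≥0∞}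
    (hf : ∀ᵐ s ∂ν, ∀ u, f s u ≤ ⨆ N, G N s u)
    (hF : ∀ N k, N ≤ k → ∀ᵐ s ∂ν, ∀ u, G N s u ≤ F k s u) :
    ∫⁻ s, ∫⁻ u, f s u ∂(η s) ∂ν ≤
      liminf (fun k => ∫⁻ s, ∫⁻ u, F k s u ∂(κ k s) ∂ν) atTop := by
  calc ∫⁻ s, ∫⁻ u, f s u ∂(η s) ∂ν ≤ ∫⁻ s, ∫⁻ u, ⨆ N, G N s u ∂(η s) ∂ν := by
        refine lintegral_mono_ae ?_
        filter_upwards [hf] with s hs using lintegral_mono hs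
    _ = ∫⁻ s, ⨆ N, ∫⁻ u, G N s u ∂(η s) ∂ν := by
        congr 1
        ext s
        exact lintegral_iSup (fun N => (hGm N).comp measurable_prodMk_left)
          fun N M hNM u => hGmono s u hNM
    _ = ⨆ N, ∫⁻ s, ∫⁻ u, G N s u ∂(η s) ∂ν := by
        refine lintegral_iSup (fun N => Measurable.lintegral_kernel_prod_right (hGm N)) ?_
        exact fun N M hNM s => lintegral_mono fun u => hGmono s u hNM
    _ ≤ liminf (fun k => ∫⁻ s, ∫⁻ u, F k s u ∂(κ k s) ∂ν) atTop := by
        refine iSup_le fun N => (h.lintegral_le_liminf hK (hGm N) (hGc N)).trans ?_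
        refine liminf_le_liminf ?_
        filter_upwards [eventually_ge_atTop N] with k hk
        refine lintegral_mono_ae ?_
        filter_upwards [hF N k hk] with s hs using lintegral_mono hs

/-- Convergence of the integrals of a dominated integrand that is continuous on sets carrying all
the controls; the dominating function `b` need not be measurable. -/
theorem RelaxedTendsto.tendsto_lintegral_of_dominated [SigmaFinite ν]
    (h : RelaxedTendsto ν κ η)
    {K : S → Set U} (hK : ∀ᵐ s ∂ν, ∀ᵐ u ∂((η + Kernel.sum κ) s), u ∈ K s)
    {f : S → U → ℝ≥0∞} (hfm : Measurable (Function.uncurry f))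
    (hfc : ∀ᵐ s ∂ν, ContinuousOn (f s) (K s)) {b : S → ℝ≥0∞}
    (hb : ∀ᵐ s ∂ν, ∀ u ∈ K s, f s u ≤ b s) (hbfin : ∫⁻ s, b s ∂ν < ⊤) :
    Tendsto (fun k => ∫⁻ s, ∫⁻ u, f s u ∂(κ k s) ∂ν) atTop
      (𝓝 (∫⁻ s, ∫⁻ u, f s u ∂(η s) ∂ν)) := by
  set m : Kernel S U := η + Kernel.sum κ
  have hη : ∀ s, η s ≤ m s := kernel_le_add_sum κ η
  have hκ : ∀ k s, κ k s ≤ m s := kernel_le_add_sum' κ η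
  let M : S → ℝ≥0∞ := fun s => essSup (f s) (m s)
  have hMm : Measurable M := measurable_essSup_kernel m hfm
  have hMfin : ∫⁻ s, M s ∂ν ≠ ⊤ := by
    refine ((lintegral_mono_ae ?_).trans_lt hbfin).ne
    filter_upwards [hK, hb] with s hs hbs
    refine essSup_le_of_ae_le _ ?_
    filter_upwards [hs] with u hu using hbs u hu
  have hMtop : ∀ᵐ s ∂ν, M s ≠ ⊤ := by
    filter_upwards [ae_lt_top hMm hMfin] with s hs using hs.ne
  have hfM : ∀ s, ∀ᵐ u ∂(m s), f s u ≤ M s := fun s => ENNReal.ae_le_essSup (f s)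
  have hdm : Measurable (Function.uncurry fun s u => M s - f s u) :=
    (hMm.comp measurable_fst).sub hfm
  have hadd : ∀ (τ : Kernel S U) [IsMarkovKernel τ], (∀ s, τ s ≤ m s) →
      ∫⁻ s, ∫⁻ u, f s u ∂(τ s) ∂ν + ∫⁻ s, ∫⁻ u, (M s - f s u) ∂(τ s) ∂ν = ∫⁻ s, M s ∂ν := by
    intro τ _ hτ
    rw [← lintegral_add_left (Measurable.lintegral_kernel_prod_right hfm)]
    congr 1
    ext s
    have hfs : Measurable (f s) := hfm.comp measurable_prodMk_left
    rw [← lintegral_add_left hfs]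
    have : ∀ᵐ u ∂(τ s), f s u + (M s - f s u) = M s := by
      filter_upwards [ae_mono (hτ s) (hfM s)] with u hu using add_tsub_cancel_of_le hu
    change ∫⁻ u, (f s u + (M s - f s u)) ∂(τ s) = M s
    rw [lintegral_congr_ae this]
    simp
  refine tendsto_of_le_liminf_of_add_eq hMfin (fun k => hadd (κ k) (hκ k)) (hadd η hη)
    (h.lintegral_le_liminf hK hfm hfc) (h.lintegral_le_liminf hK hdm ?_)
  filter_upwards [hfc, hMtop] with s hs hMs
  exact (ENNReal.continuous_sub_left hMs).comp_continuousOn hs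

end LowerSemicontinuity

section Survival

theorem abs_exp_neg_sub_exp_neg_le {a b : ℝ} (ha : 0 ≤ a) (hb : 0 ≤ b) :
    |Real.exp (-a) - Real.exp (-b)| ≤ |a - b| := by
  wlog hab : a ≤ b generalizing a b
  · rw [abs_sub_comm, abs_sub_comm a]
    exact this hb ha (le_of_not_ge hab)
  have h1 : Real.exp (-b) ≤ Real.exp (-a) := Real.exp_le_exp.2 (by linarith)
  rw [abs_of_nonneg (by linarith), abs_of_nonpos (by linarith)]
  have h2 : Real.exp (-b) = Real.exp (-a) * Real.exp (a - b) := by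
    rw [← Real.exp_add]; ring_nf
  have h3 := Real.add_one_le_exp (a - b)
  have h4 : Real.exp (-a) ≤ 1 := Real.exp_le_one_iff.2 (by linarith)
  rw [h2]
  nlinarith [Real.exp_pos (-a)]

theorem integral_mul_exp_neg_integral {l : ℝ → ℝ} (h0 : ∀ s, 0 ≤ l s) {T : ℝ} (hT : 0 ≤ T)
    (hi : IntervalIntegrable l volume 0 T) :
    IntervalIntegrable (fun s => l s * Real.exp (-∫ r in (0:ℝ)..s, l r)) volume 0 T ∧
    ∫ s in (0:ℝ)..T, l s * Real.exp (-∫ r in (0:ℝ)..s, l r)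
      = 1 - Real.exp (-∫ r in (0:ℝ)..T, l r) := by
  set F : ℝ → ℝ := fun t => ∫ r in (0:ℝ)..t, l r with hF
  have hac : AbsolutelyContinuousOnInterval F 0 T :=
    hi.absolutelyContinuousOnInterval_intervalIntegral (by simp)
  have hF0 : ∀ t ∈ uIcc 0 T, 0 ≤ F t := by
    intro t ht
    rw [uIcc_of_le hT] at ht
    exact intervalIntegral.integral_nonneg ht.1 fun s _ => h0 s
  have hac' : AbsolutelyContinuousOnInterval (fun t => Real.exp (-F t)) 0 T := by
    refine squeeze_zero' (Eventually.of_forall fun _ => Finset.sum_nonneg fun _ _ => dist_nonneg)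
      ?_ hac
    refine eventually_inf_principal.2 (Eventually.of_forall fun I hI => ?_)
    refine Finset.sum_le_sum fun i hi => ?_
    exact abs_exp_neg_sub_exp_neg_le (hF0 _ (hI.1 i hi).1) (hF0 _ (hI.1 i hi).2)
  have hd : ∀ᵐ s, s ∈ uIoc 0 T →
      l s * Real.exp (-F s) = -deriv (fun t => Real.exp (-F t)) s := by
    filter_upwards [hi.ae_hasDerivAt_integral] with s hs hsT
    have h1 : HasDerivAt F (l s) s := hs (uIoc_subset_uIcc hsT) 0 (by simp)
    have h2 : HasDerivAt (fun t => Real.exp (-F t)) (Real.exp (-F s) * -l s) s := h1.neg.exp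
    rw [h2.deriv]
    ring
  constructor
  · refine hac'.intervalIntegrable_deriv.neg.congr_ae ?_
    rw [EventuallyEq, ae_restrict_iff' measurableSet_uIoc]
    filter_upwards [hd] with s hs hsT using (hs hsT).symm
  · rw [intervalIntegral.integral_congr_ae hd, intervalIntegral.integral_neg,
      hac'.integral_deriv_eq_sub]
    simp [F]

/-- The discounted survival function `t ↦ exp(-αt - ∫₀ᵗ I)` of a hazard rate `I`. -/
def survival (α : ℝ) (I : ℝ → ℝ≥0∞) (t : ℝ) : ℝ :=
  Real.exp (-(α * t) - (∫⁻ s in Ioc 0 t, I s).toReal)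

theorem measurable_survival (α : ℝ) (I : ℝ → ℝ≥0∞) : Measurable (survival α I) := by
  have h : Monotone fun t : ℝ => ∫⁻ s in Ioc 0 t, I s := fun s t hst =>
    lintegral_mono_set (Ioc_subset_Ioc_right hst)
  have := h.measurable.ennreal_toReal
  unfold survival
  fun_prop

theorem survival_pos (α : ℝ) (I : ℝ → ℝ≥0∞) (t : ℝ) : 0 < survival α I t := Real.exp_pos _

theorem survival_antitone {α : ℝ} (hα : 0 ≤ α) {I : ℝ → ℝ≥0∞} {s t : ℝ} (hst : s ≤ t)
    (hfin : ∫⁻ r in Ioc 0 t, I r ≠ ⊤) : survival α I t ≤ survival α I s := by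
  have h1 : (∫⁻ r in Ioc 0 s, I r).toReal ≤ (∫⁻ r in Ioc 0 t, I r).toReal :=
    ENNReal.toReal_mono hfin (lintegral_mono_set (Ioc_subset_Ioc_right hst))
  have h2 : α * s ≤ α * t := by gcongr
  exact Real.exp_le_exp.2 (by linarith)

theorem lintegral_survival_mul_add {α : ℝ} (hα : 0 ≤ α) {I : ℝ → ℝ≥0∞} (hI : Measurable I) {T : ℝ}
    (hT : 0 ≤ T) (hfin : ∫⁻ s in Ioc 0 T, I s ≠ ⊤) :
    (∫⁻ s in Ioc 0 T, ENNReal.ofReal (survival α I s) * I s) + ENNReal.ofReal (survival α I T)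
      + ENNReal.ofReal α * (∫⁻ s in Ioc 0 T, ENNReal.ofReal (survival α I s)) = 1 := by
  have hint : IntegrableOn (fun s => (I s).toReal) (Ioc 0 T) :=
    integrable_toReal_of_lintegral_ne_top hI.aemeasurable hfin
  have hItop : ∀ᵐ s ∂(volume.restrict (Ioc 0 T)), I s < ⊤ := ae_lt_top hI hfin
  have hii : IntervalIntegrable (fun s => (I s).toReal) volume 0 T :=
    (intervalIntegrable_iff_integrableOn_Ioc_of_le hT).2 hint
  have hl : IntervalIntegrable (fun s => (I s).toReal + α) volume 0 T :=
    hii.add intervalIntegrable_const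
  have hF : ∀ t ∈ Icc 0 T, Real.exp (-∫ r in (0:ℝ)..t, ((I r).toReal + α)) = survival α I t := by
    intro t ht
    have hsub : Ioc 0 t ⊆ Ioc 0 T := Ioc_subset_Ioc_right ht.2
    have hit : IntervalIntegrable (fun s => (I s).toReal) volume 0 t :=
      (intervalIntegrable_iff_integrableOn_Ioc_of_le ht.1).2 (hint.mono_set hsub)
    rw [intervalIntegral.integral_add hit intervalIntegrable_const,
      intervalIntegral.integral_of_le ht.1, integral_toReal hI.aemeasurable
        (ae_mono (Measure.restrict_mono hsub le_rfl) hItop)]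
    simp only [intervalIntegral.integral_const, survival, smul_eq_mul]
    congr 1
    ring
  obtain ⟨hgi, hg⟩ := integral_mul_exp_neg_integral
    (fun s => add_nonneg ENNReal.toReal_nonneg hα) hT hl
  have hgi' := (intervalIntegrable_iff_integrableOn_Ioc_of_le hT).1 hgi
  rw [intervalIntegral.integral_of_le hT, hF T ⟨hT, le_rfl⟩] at hg
  have hg' := ofReal_integral_eq_lintegral_ofReal hgi' (Eventually.of_forall fun s =>
    mul_nonneg (add_nonneg ENNReal.toReal_nonneg hα) (Real.exp_pos _).le)
  rw [hg] at hg'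
  have hS := (measurable_survival α I).ennreal_ofReal
  have hsplit : ∫⁻ s in Ioc 0 T, ENNReal.ofReal (((I s).toReal + α) *
        Real.exp (-∫ r in (0:ℝ)..s, ((I r).toReal + α)))
      = (∫⁻ s in Ioc 0 T, ENNReal.ofReal (survival α I s) * I s)
        + ENNReal.ofReal α * ∫⁻ s in Ioc 0 T, ENNReal.ofReal (survival α I s) := by
    have hSI : Measurable fun s => ENNReal.ofReal (survival α I s) * I s := hS.mul hI
    rw [← lintegral_const_mul _ hS, ← lintegral_add_left hSI]
    refine lintegral_congr_ae ?_
    filter_upwards [hItop, ae_restrict_mem measurableSet_Ioc] with s hs hsT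
    rw [hF s ⟨hsT.1.le, hsT.2⟩, ENNReal.ofReal_mul (add_nonneg ENNReal.toReal_nonneg hα),
      ENNReal.ofReal_add ENNReal.toReal_nonneg hα, ENNReal.ofReal_toReal hs.ne]
    ring
  have hle : survival α I T ≤ 1 := by
    refine Real.exp_le_one_iff.2 ?_
    have : 0 ≤ α * T := mul_nonneg hα hT
    have : 0 ≤ (∫⁻ s in Ioc 0 T, I s).toReal := ENNReal.toReal_nonneg
    linarith
  rw [add_right_comm, ← hsplit, ← hg', ← ENNReal.ofReal_add (by linarith) (survival_pos α I T).le]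
  simp

theorem exists_survival_lt {α : ℝ} {I : ℝ → ℝ≥0∞}
    (hs : ∫⁻ s in Ici 0, ENNReal.ofReal (survival α I s) ≠ ⊤) {ε : ℝ} (hε : 0 < ε) :
    ∃ t, 0 ≤ t ∧ survival α I t < ε := by
  by_contra! h
  refine hs (top_le_iff.1 ?_)
  calc (⊤ : ℝ≥0∞) = ∫⁻ _ in Ici (0:ℝ), ENNReal.ofReal ε := by
        simp [ENNReal.mul_top, hε]
    _ ≤ _ := setLIntegral_mono' measurableSet_Ici fun s hs => ENNReal.ofReal_le_ofReal (h s hs)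

theorem sInf_survival_eq_zero {α : ℝ} {I : ℝ → ℝ≥0∞}
    (hs : ∫⁻ s in Ici 0, ENNReal.ofReal (survival α I s) ≠ ⊤) :
    sInf (survival α I '' Ici 0) = 0 := by
  have hbdd : ∀ y ∈ survival α I '' Ici 0, 0 ≤ y := by
    rintro _ ⟨t, -, rfl⟩
    exact (survival_pos α I t).le
  refine le_antisymm (le_of_forall_pos_lt_add fun ε hε => ?_) (Real.sInf_nonneg hbdd)
  obtain ⟨t, ht, hlt⟩ := exists_survival_lt hs hε
  rw [zero_add]
  exact (csInf_le ⟨0, hbdd⟩ ⟨t, ht, rfl⟩).trans_lt hlt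

theorem lintegral_Ici_survival_mul_add {α : ℝ} (hα : 0 ≤ α) {I : ℝ → ℝ≥0∞} (hI : Measurable I)
    (hfin : ∀ T, 0 ≤ T → ∫⁻ s in Ioc 0 T, I s ≠ ⊤)
    (hs : ∫⁻ s in Ici 0, ENNReal.ofReal (survival α I s) ≠ ⊤) :
    (∫⁻ s in Ici 0, ENNReal.ofReal (survival α I s) * I s)
      + ENNReal.ofReal α * (∫⁻ s in Ici 0, ENNReal.ofReal (survival α I s)) = 1 := by
  have hS := (measurable_survival α I).ennreal_ofReal
  have hlim : ∀ g : ℝ → ℝ≥0∞, Measurable g →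
      Tendsto (fun N : ℕ => ∫⁻ s in Ioc 0 (N : ℝ), g s) atTop (𝓝 (∫⁻ s in Ici 0, g s)) := by
    intro g hg
    have hc : AECover (volume.restrict (Ici (0:ℝ))) atTop fun N : ℕ => Iic (N : ℝ) :=
      aecover_Iic tendsto_natCast_atTop_atTop
    have := hc.lintegral_tendsto_of_nat hg.aemeasurable
    refine this.congr fun N => ?_
    rw [Measure.restrict_restrict measurableSet_Iic, inter_comm, Ici_inter_Iic,
      Measure.restrict_congr_set Ioc_ae_eq_Icc]
  have hsurv : Tendsto (fun N : ℕ => ENNReal.ofReal (survival α I N)) atTop (𝓝 0) := by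
    rw [← ENNReal.ofReal_zero]
    refine ENNReal.tendsto_ofReal (tendsto_order.2 ⟨fun a ha => Eventually.of_forall fun N =>
      ha.trans (survival_pos α I N), fun ε hε => ?_⟩)
    obtain ⟨t, ht, hlt⟩ := exists_survival_lt hs hε
    filter_upwards [tendsto_natCast_atTop_atTop.eventually_ge_atTop t] with N hN
    exact (survival_antitone hα hN (hfin N (Nat.cast_nonneg N))).trans_lt hlt
  have h := ((hlim _ (hS.mul hI)).add hsurv).add
    (ENNReal.Tendsto.const_mul (a := ENNReal.ofReal α) (hlim _ hS) (Or.inr ENNReal.ofReal_ne_top))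
  rw [add_zero] at h
  refine tendsto_nhds_unique h (tendsto_const_nhds.congr fun N => ?_)
  exact (lintegral_survival_mul_add hα hI (Nat.cast_nonneg N) (hfin N (Nat.cast_nonneg N))).symm

end Survival

section WeightedLowerSemicontinuity

theorem ENNReal.mul_le_iSup_mul {f g : ℕ → ℝ≥0∞} (hf : Monotone f) (hg : Monotone g) :
    (⨆ N, f N) * (⨆ N, g N) ≤ ⨆ N, f N * g N := by
  rw [ENNReal.iSup_mul]
  refine iSup_le fun i => ?_
  rw [ENNReal.mul_iSup]
  refine iSup_le fun j => ?_
  refine le_trans ?_ (le_iSup (fun N => f N * g N) (max i j))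
  exact mul_le_mul' (hf (le_max_left i j)) (hg (le_max_right i j))

theorem liminf_ofReal_add_le {w : ℕ → ℝ} {c : ℝ} (hw : ∀ k, -c ≤ w k) :
    ENNReal.ofReal (liminf w atTop + c) ≤ liminf (fun k => ENNReal.ofReal (w k + c)) atTop := by
  refine ENNReal.le_of_forall_pos_le_add fun ε hε _ => ?_
  have hb : IsBoundedUnder (· ≥ ·) atTop w := isBoundedUnder_of ⟨-c, hw⟩
  have h1 : ∀ᶠ k in atTop, liminf w atTop - ε < w k :=
    eventually_lt_of_lt_liminf (by simpa using hε) hb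
  have h2 : ENNReal.ofReal (liminf w atTop - ε + c) ≤
      liminf (fun k => ENNReal.ofReal (w k + c)) atTop := by
    refine le_liminf_of_le (by isBoundedDefault) ?_
    filter_upwards [h1] with k hk using ENNReal.ofReal_le_ofReal (by linarith)
  calc ENNReal.ofReal (liminf w atTop + c)
      = ENNReal.ofReal ((liminf w atTop - ε + c) + ε) := by ring_nf
    _ ≤ ENNReal.ofReal (liminf w atTop - ε + c) + ENNReal.ofReal ε := ENNReal.ofReal_add_le
    _ ≤ _ := by
        rw [ENNReal.ofReal_coe_nnreal]
        gcongr

variable {S : Type*} [MeasurableSpace S] [MetricSpace U] [MeasurableSpace U]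
  {ν : Measure S} {κ : ℕ → Kernel S U} {η : Kernel S U}

theorem RelaxedTendsto.restrict (h : RelaxedTendsto ν κ η) {B : Set S} (hB : MeasurableSet B) :
    RelaxedTendsto (ν.restrict B) κ η := by
  rintro g hgm hgc ⟨C, A, hA, hνA, hg⟩
  have heq : ∀ τ : Kernel S U, ∫ s in B, ∫ u, g s u ∂(τ s) ∂ν
      = ∫ s, ∫ u, B.indicator (fun s => g s u) s ∂(τ s) ∂ν := by
    intro τ
    rw [← integral_indicator hB]
    congr 1
    ext s
    by_cases hs : s ∈ B <;> simp [hs]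
  simp_rw [heq]
  refine h (fun s u => B.indicator (fun s => g s u) s) ?_ ?_ ⟨C, A ∩ B, hA.inter hB, ?_, ?_⟩
  · have : (Function.uncurry fun s u => B.indicator (fun s => g s u) s)
        = (Prod.fst ⁻¹' B).indicator (Function.uncurry g) := by
      ext ⟨s, u⟩
      by_cases hs : s ∈ B <;> simp [hs]
    rw [this]
    exact hgm.indicator (measurable_fst hB)
  · intro s
    by_cases hs : s ∈ B
    · simpa [hs] using hgc s
    · simpa [hs] using continuous_const
  · rwa [← Measure.restrict_apply hA]
  · intro s u
    have := hg s u
    by_cases hs : s ∈ B <;> by_cases hs' : s ∈ A <;> simp_all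

/-- Lower semicontinuity for integrands with a varying weight in the first variable. -/
theorem RelaxedTendsto.lintegral_weight_mul_le_liminf [CompactSpace U] [BorelSpace U]
    [∀ k, IsMarkovKernel (κ k)] [IsMarkovKernel η] [SigmaFinite ν] (h : RelaxedTendsto ν κ η)
    {K : S → Set U} (hK : ∀ᵐ s ∂ν, ∀ᵐ u ∂((η + Kernel.sum κ) s), u ∈ K s)
    {e : ℕ → S → ℝ≥0∞} {e' : S → ℝ≥0∞} (hem : ∀ k, Measurable (e k))
    (hetop : ∀ k s, e k s ≠ ⊤) (hetop' : ∀ s, e' s ≠ ⊤)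
    (he : ∀ᵐ s ∂ν, Tendsto (fun k => e k s) atTop (𝓝 (e' s)))
    {c : ℕ → S → U → ℝ≥0∞} (hcm : ∀ N, Measurable (Function.uncurry (c N)))
    (hcc : ∀ N, ∀ᵐ s ∂ν, ContinuousOn (c N s) (K s)) (hcmono : ∀ s u, Monotone fun N => c N s u)
    {f : S → U → ℝ≥0∞} {F : ℕ → S → U → ℝ≥0∞}
    (hf : ∀ᵐ s ∂ν, ∀ u, f s u ≤ ⨆ N, c N s u)
    (hF : ∀ N k, N ≤ k → ∀ᵐ s ∂ν, ∀ u, c N s u ≤ F k s u) :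
    ∫⁻ s, e' s * ∫⁻ u, f s u ∂(η s) ∂ν ≤
      liminf (fun k => ∫⁻ s, e k s * ∫⁻ u, F k s u ∂(κ k s) ∂ν) atTop := by
  let w : ℕ → S → ℝ≥0∞ := fun N s => ⨅ k ≥ N, e k s
  have hwm : ∀ N, Measurable (w N) := fun N =>
    Measurable.biInf _ (to_countable _) fun k _ => hem k
  have hwle : ∀ N k s, N ≤ k → w N s ≤ e k s := fun N k s hNk => iInf₂_le k hNk
  have hwtop : ∀ N s, w N s ≠ ⊤ := fun N s => ((hwle N N s le_rfl).trans_lt (hetop N s).lt_top).ne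
  have hwmono : ∀ s, Monotone fun N => w N s := fun s N M hNM =>
    biInf_mono fun k hk => le_trans hNM hk
  simp_rw [← fun s => lintegral_const_mul' (μ := η s) (e' s) (f s) (hetop' s),
    ← fun k s => lintegral_const_mul' (μ := κ k s) (e k s) (F k s) (hetop k s)]
  refine h.lintegral_le_liminf_of_approx hK (G := fun N s u => w N s * c N s u) ?_ ?_ ?_
    (f := fun s u => e' s * f s u) (F := fun k s u => e k s * F k s u) ?_ ?_
  · exact fun N => ((hwm N).comp measurable_fst).mul (hcm N)
  · intro N
    filter_upwards [hcc N] with s hs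
    exact (ENNReal.continuous_const_mul (hwtop N s)).comp_continuousOn hs
  · exact fun s u N M hNM => mul_le_mul' (hwmono s hNM) (hcmono s u hNM)
  · filter_upwards [he, hf] with s hs hfs u
    have hlim : e' s = ⨆ N, w N s := by rw [← hs.liminf_eq, liminf_eq_iSup_iInf_of_nat]
    rw [hlim]
    exact (mul_le_mul' le_rfl (hfs u)).trans (ENNReal.mul_le_iSup_mul (hwmono s) (hcmono s u))
  · intro N k hNk
    filter_upwards [hF N k hNk] with s hs u
    exact mul_le_mul' (hwle N k s hNk) (hs u)

/-- A version on a single measure of `RelaxedTendsto.lintegral_weight_mul_le_liminf`. -/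
theorem mul_lintegral_le_liminf_of_tendsto_integral [CompactSpace U] [BorelSpace U]
    {m : ℕ → Measure U} {m' : Measure U} [∀ k, IsProbabilityMeasure (m k)]
    [IsProbabilityMeasure m']
    (h : ∀ g : U → ℝ, Continuous g → Tendsto (fun k => ∫ u, g u ∂(m k)) atTop (𝓝 (∫ u, g u ∂m')))
    {K : Set U} (hK' : ∀ᵐ u ∂m', u ∈ K) (hK : ∀ k, ∀ᵐ u ∂(m k), u ∈ K)
    {e : ℕ → ℝ≥0∞} {e' : ℝ≥0∞} (hetop : ∀ k, e k ≠ ⊤) (hetop' : e' ≠ ⊤)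
    (he : Tendsto e atTop (𝓝 e')) {c : ℕ → U → ℝ≥0∞} (hcm : ∀ N, Measurable (c N))
    (hcc : ∀ N, ContinuousOn (c N) K) (hcmono : ∀ u, Monotone fun N => c N u)
    {f : U → ℝ≥0∞} {F : ℕ → U → ℝ≥0∞} (hf : ∀ u, f u ≤ ⨆ N, c N u)
    (hF : ∀ N k, N ≤ k → ∀ u, c N u ≤ F k u) :
    e' * ∫⁻ u, f u ∂m' ≤ liminf (fun k => e k * ∫⁻ u, F k u ∂(m k)) atTop := by
  have hR : RelaxedTendsto (Measure.dirac ()) (fun k => Kernel.const Unit (m k))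
      (Kernel.const Unit m') := fun g _ hgc _ => by simpa using h (g ()) (hgc ())
  have hKae : ∀ᵐ s ∂(Measure.dirac ()), ∀ᵐ u ∂((Kernel.const Unit m' +
      Kernel.sum fun k => Kernel.const Unit (m k)) s), u ∈ K := by
    refine Eventually.of_forall fun s => ?_
    rw [_root_.add_apply, Kernel.sum_apply, ae_add_measure_iff, Measure.ae_sum_iff]
    exact ⟨hK', hK⟩
  simpa using hR.lintegral_weight_mul_le_liminf hKae (e := fun k _ => e k) (e' := fun _ => e')
    (fun _ => measurable_const) (fun k _ => hetop k) (fun _ => hetop')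
    (Eventually.of_forall fun _ => he) (c := fun N _ u => c N u)
    (fun N => (hcm N).comp measurable_snd) (fun N => Eventually.of_forall fun _ => hcc N)
    (fun _ u => hcmono u) (f := fun _ u => f u) (F := fun k _ u => F k u)
    (Eventually.of_forall fun _ => hf) (fun N k hNk => Eventually.of_forall fun _ => hF N k hNk)

theorem relaxedTendsto_of_forall_integrable_iSup [CompactSpace U] [BorelSpace U] [Nonempty U]
    (h : ∀ g : S → U → ℝ, Measurable (fun p : S × U => g p.1 p.2) → (∀ s, Continuous (g s)) →
      Integrable (fun s => ⨆ u : U, |g s u|) ν →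
      Tendsto (fun k => ∫ s, ∫ u, g s u ∂(κ k s) ∂ν) atTop (𝓝 (∫ s, ∫ u, g s u ∂(η s) ∂ν))) :
    RelaxedTendsto ν κ η := by
  rintro g hgm hgc ⟨C, A, hA, hνA, hg⟩
  refine h g hgm hgc ?_
  have hint : Integrable (A.indicator fun _ => C) ν := by
    rw [integrable_indicator_iff hA]
    exact integrableOn_const hνA.ne
  have hmeas : Measurable fun s => ⨆ u : U, |g s u| := by
    have : ∀ s, ⨆ u : U, |g s u| = ⨆ i : ℕ, |g s (TopologicalSpace.denseSeq U i)| := by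
      intro s
      rw [← (TopologicalSpace.denseRange_denseSeq U).ciSup' (hgc s).abs,
        ← rangeFactorization_surjective.iSup_comp]
      rfl
    simp_rw [this]
    refine Measurable.iSup fun i => ?_
    have : Measurable fun s => g s (TopologicalSpace.denseSeq U i) :=
      hgm.comp measurable_prodMk_right
    exact this.abs
  refine hint.mono' hmeas.aestronglyMeasurable (Eventually.of_forall fun s => ?_)
  rw [Real.norm_of_nonneg (Real.iSup_nonneg fun u => abs_nonneg _)]
  exact ciSup_le (hg s)

end WeightedLowerSemicontinuity

section Flow

variable {E : Set (Rn n)} {φ : Rn n → ℝ → Rn n} {Δ : Rn n} {x : Rn n}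

theorem domSet_of_tstar_eq_top (h : tstar E φ x = ⊤) : domSet E φ x = Ici 0 := by
  ext s
  simp [domSet, h]

theorem domSet_of_tstar_ne_top (h : tstar E φ x ≠ ⊤) :
    domSet E φ x = Ico 0 (tstar E φ x).toReal := by
  ext s
  simp only [domSet, mem_ofPred_eq, mem_Ico]
  refine and_congr_right fun hs => ?_
  rw [ENNReal.ofReal_lt_iff_lt_toReal hs h]

theorem measurableSet_domSet : MeasurableSet (domSet E φ x) := by
  by_cases h : tstar E φ x = ⊤
  · rw [domSet_of_tstar_eq_top h]
    exact measurableSet_Ici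
  · rw [domSet_of_tstar_ne_top h]
    exact measurableSet_Ico

theorem domSet_subset_Ici : domSet E φ x ⊆ Ici 0 := fun _ hs => hs.1

theorem Icc_subset_domSet {t : ℝ} (ht : t ∈ domSet E φ x) : Icc 0 t ⊆ domSet E φ x :=
  fun _ hs => ⟨hs.1, (ENNReal.ofReal_le_ofReal hs.2).trans_lt ht.2⟩

theorem Ioc_ae_eq_domSet (h : tstar E φ x ≠ ⊤) :
    (Ioc 0 (tstar E φ x).toReal : Set ℝ) =ᵐ[volume] domSet E φ x := by
  rw [domSet_of_tstar_ne_top h]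
  exact Ico_ae_eq_Ioc.symm

theorem continuousOn_flow
    (hφ : ContinuousOn (fun p : Rn n × ℝ => φ p.1 p.2) (Set.univ ×ˢ Set.Ici 0)) (x : Rn n) :
    ContinuousOn (φ x) (Ici 0) :=
  hφ.comp (f := fun t : ℝ => (x, t)) (by fun_prop) fun t ht => ⟨mem_univ _, ht⟩

theorem continuous_flow_max
    (hφ : ContinuousOn (fun p : Rn n × ℝ => φ p.1 p.2) (Set.univ ×ˢ Set.Ici 0)) (x : Rn n) :
    Continuous fun s => φ x (max s 0) :=
  (continuousOn_flow hφ x).comp_continuous (by fun_prop) fun s => le_max_right s 0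

theorem flow_mem_of_mem_domSet (hE : IsOpen E)
    (hφ : ContinuousOn (fun p : Rn n × ℝ => φ p.1 p.2) (Set.univ ×ˢ Set.Ici 0))
    (hφ0 : φ x 0 = x) (hx : x ∈ E) {s : ℝ} (hs : s ∈ domSet E φ x) : φ x s ∈ E := by
  have hpre : IsPreconnected (φ x '' Icc 0 s) := isPreconnected_Icc.image _
    ((continuousOn_flow hφ x).mono Icc_subset_Ici_self)
  refine hpre.subset_of_closure_inter_subset hE ⟨x, ⟨0, ⟨le_rfl, hs.1⟩, hφ0⟩, hx⟩ ?_
    ⟨s, ⟨hs.1, le_rfl⟩, rfl⟩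
  rintro _ ⟨hcl, t, ht, rfl⟩
  by_contra hnot
  have hfr : φ x t ∈ frontier E := ⟨hcl, by rwa [hE.interior_eq]⟩
  have ht0 : 0 < t := by
    refine lt_of_le_of_ne ht.1 fun h0 => hnot ?_
    rwa [← h0, hφ0]
  have h1 : tstar E φ x ≤ ENNReal.ofReal t := iInf₂_le t ⟨ht0, hfr⟩
  exact (h1.trans (ENNReal.ofReal_le_ofReal ht.2)).not_gt hs.2

theorem flowBd_mem_frontier (hΔ : Δ ∈ frontier E)
    (hφ : ContinuousOn (fun p : Rn n × ℝ => φ p.1 p.2) (Set.univ ×ˢ Set.Ici 0)) :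
    flowBd E φ Δ x ∈ frontier E := by
  unfold flowBd
  split_ifs with h
  swap
  · exact hΔ
  have hclosed : IsClosed (Ici (0:ℝ) ∩ φ x ⁻¹' frontier E) :=
    (continuousOn_flow hφ x).preimage_isClosed_of_isClosed isClosed_Ici isClosed_frontier
  have hsub : {t : ℝ | 0 < t ∧ φ x t ∈ frontier E} ⊆ Ici (0:ℝ) ∩ φ x ⁻¹' frontier E :=
    fun t ht => ⟨ht.1.le, ht.2⟩
  refine (closure_minimal hsub hclosed (Metric.mem_closure_iff.2 fun ε hε => ?_)).2
  have hlt : tstar E φ x < ENNReal.ofReal ((tstar E φ x).toReal + ε) := by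
    rw [ENNReal.lt_ofReal_iff_toReal_lt h]
    linarith
  obtain ⟨t, ht⟩ := iInf_lt_iff.1 hlt
  obtain ⟨htA, ht⟩ := iInf_lt_iff.1 ht
  refine ⟨t, htA, ?_⟩
  have h1 : t < (tstar E φ x).toReal + ε :=
    lt_of_not_ge fun hge => ht.not_ge (ENNReal.ofReal_le_ofReal hge)
  have h2 : (tstar E φ x).toReal ≤ t := by
    have : tstar E φ x ≤ ENNReal.ofReal t := iInf₂_le t htA
    simpa [ENNReal.toReal_ofReal htA.1.le] using ENNReal.toReal_mono ENNReal.ofReal_ne_top this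
  rw [dist_comm, Real.dist_eq, abs_of_nonneg (by linarith)]
  linarith

end Flow

theorem le_sSup_image_of_mem [TopologicalSpace U] {E : Set (Rn n)} {Uc : Rn n → Set U}
    {lam : Rn n → U → ℝ} (hUc : ∀ y ∈ closure E, IsCompact (Uc y))
    (hlamc : ∀ y ∈ closure E, ContinuousOn (fun a => lam y a) (Uc y)) {y : Rn n} (hy : y ∈ E)
    {u : U} (hu : u ∈ Uc y) : lam y u ≤ sSup (lam y '' Uc y) :=
  le_csSup ((hUc y (subset_closure hy)).bddAbove_image (hlamc y (subset_closure hy)))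
    (mem_image_of_mem _ hu)

section RelaxedControl

variable [MeasurableSpace U] {E : Set (Rn n)} {φ : Rn n → ℝ → Rn n} {Δ : Rn n}
  {Uc : Rn n → Set U} {lam : Rn n → U → ℝ} {x : Rn n}

/-- The jump rate at time `s` under the relaxed control `μ`; negative times are sent to `0`. -/
def jumpRate (φ : Rn n → ℝ → Rn n) (lam : Rn n → U → ℝ) (x : Rn n) (μ : ℝ → Measure U)
    (s : ℝ) : ℝ≥0∞ :=
  ∫⁻ u, ENNReal.ofReal (lam (φ x (max s 0)) u) ∂(μ s)

theorem measurable_uncurry_flow_max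
    (hφ : ContinuousOn (fun p : Rn n × ℝ => φ p.1 p.2) (Set.univ ×ˢ Set.Ici 0)) (x : Rn n)
    {β : Type*} [MeasurableSpace β] {g : Rn n → U → β}
    (hg : Measurable fun p : Rn n × U => g p.1 p.2) :
    Measurable (Function.uncurry fun s u => g (φ x (max s 0)) u) :=
  hg.comp (((continuous_flow_max hφ x).measurable.comp measurable_fst).prodMk measurable_snd)

theorem measurable_jumpRate
    (hφ : ContinuousOn (fun p : Rn n × ℝ => φ p.1 p.2) (Set.univ ×ˢ Set.Ici 0))
    (hlam : Measurable fun p : Rn n × U => lam p.1 p.2) {μ : ℝ → Measure U} (hμ : Measurable μ)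
    [∀ s, IsProbabilityMeasure (μ s)] : Measurable (jumpRate φ lam x μ) := by
  let κ : Kernel ℝ U := ⟨μ, hμ⟩
  have : IsMarkovKernel κ := ⟨fun s => inferInstanceAs (IsProbabilityMeasure (μ s))⟩
  exact Measurable.lintegral_kernel_prod_right (κ := κ)
    (measurable_uncurry_flow_max hφ x (g := fun y u => ENNReal.ofReal (lam y u))
      hlam.ennreal_ofReal)

theorem rE_eq_survival
    (hφ : ContinuousOn (fun p : Rn n × ℝ => φ p.1 p.2) (Set.univ ×ˢ Set.Ici 0))
    (hlam : Measurable fun p : Rn n × U => lam p.1 p.2) (hlam0 : ∀ y a, 0 ≤ lam y a)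
    {μ : ℝ → Measure U} (hμ : Measurable μ) [∀ s, IsProbabilityMeasure (μ s)] (α : ℝ) {t : ℝ}
    (ht : 0 ≤ t) (hfin : ∫⁻ s in Ioc 0 t, jumpRate φ lam x μ s ≠ ⊤) :
    rE φ lam α x μ t = survival α (jumpRate φ lam x μ) t := by
  have hm := measurable_jumpRate (x := x) hφ hlam hμ
  unfold rE survival rLam
  rw [intervalIntegral.integral_of_le ht,
    ← integral_toReal hm.aemeasurable (ae_lt_top hm hfin)]
  congr 2
  refine setIntegral_congr_fun measurableSet_Ioc fun s hs => ?_
  have hml : Measurable (lam (φ x s)) := hlam.comp measurable_prodMk_left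
  simp only [jumpRate, max_eq_left hs.1.le]
  exact integral_eq_lintegral_of_nonneg_ae (Eventually.of_forall fun u => hlam0 _ u)
    hml.aestronglyMeasurable

theorem ae_mem_of_measure_eq_one [TopologicalSpace U] [T2Space U] [OpensMeasurableSpace U]
    {m : Measure U} [IsProbabilityMeasure m] {K : Set U} (hK : IsCompact K) (h : m K = 1) :
    ∀ᵐ u ∂m, u ∈ K :=
  (prob_compl_eq_zero_iff hK.isClosed.measurableSet).2 h

theorem ae_domSet_ae_mem [TopologicalSpace U] [T2Space U] [OpensMeasurableSpace U]
    (hE : IsOpen E)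
    (hφ : ContinuousOn (fun p : Rn n × ℝ => φ p.1 p.2) (Set.univ ×ˢ Set.Ici 0))
    (hφ0 : φ x 0 = x) (hx : x ∈ E) (hUc : ∀ y ∈ closure E, IsCompact (Uc y))
    {Θ : (ℝ → Measure U) × Measure U} (h : Θ ∈ RelSet E φ Δ Uc x) :
    ∀ᵐ s ∂(volume.restrict (domSet E φ x)), ∀ᵐ u ∂(Θ.1 s), u ∈ Uc (φ x s) := by
  have h1 : ∀ᵐ s ∂(volume.restrict (domSet E φ x)), Θ.1 s (Uc (φ x s)) = 1 :=
    ae_mono (Measure.restrict_mono domSet_subset_Ici le_rfl) h.2.2.1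
  filter_upwards [h1, ae_restrict_mem measurableSet_domSet] with s hs hsD
  have := h.2.1 s
  exact ae_mem_of_measure_eq_one
    (hUc _ (subset_closure (flow_mem_of_mem_domSet hE hφ hφ0 hx hsD))) hs

theorem ofReal_le_jumpRate {μ : ℝ → Measure U} [∀ s, IsProbabilityMeasure (μ s)]
    (hμ : ∀ᵐ s ∂(volume.restrict (domSet E φ x)), ∀ᵐ u ∂(μ s), u ∈ Uc (φ x s))
    {ξ : Rn n → ℝ} (hE : ∀ s ∈ domSet E φ x, φ x s ∈ E)
    (hξ : ∀ y ∈ E, ∀ a ∈ Uc y, ξ y ≤ lam y a) :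
    ∀ᵐ s ∂(volume.restrict (domSet E φ x)), ENNReal.ofReal (ξ (φ x s)) ≤
      jumpRate φ lam x μ s := by
  filter_upwards [hμ, ae_restrict_mem measurableSet_domSet] with s hs hsD
  calc ENNReal.ofReal (ξ (φ x s)) = ∫⁻ _, ENNReal.ofReal (ξ (φ x s)) ∂(μ s) := by simp
    _ ≤ _ := by
      refine lintegral_mono_ae ?_
      filter_upwards [hs] with u hu
      rw [max_eq_left hsD.1]
      exact ENNReal.ofReal_le_ofReal (hξ _ (hE s hsD) u hu)

theorem jumpRate_le_ofReal_sSup [TopologicalSpace U] {μ : ℝ → Measure U}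
    [∀ s, IsProbabilityMeasure (μ s)]
    (hμ : ∀ᵐ s ∂(volume.restrict (domSet E φ x)), ∀ᵐ u ∂(μ s), u ∈ Uc (φ x s))
    (hE : ∀ s ∈ domSet E φ x, φ x s ∈ E) (hUc : ∀ y ∈ closure E, IsCompact (Uc y))
    (hlamc : ∀ y ∈ closure E, ContinuousOn (fun a => lam y a) (Uc y)) :
    ∀ᵐ s ∂(volume.restrict (domSet E φ x)), jumpRate φ lam x μ s ≤
      ENNReal.ofReal (sSup (lam (φ x s) '' Uc (φ x s))) := by
  filter_upwards [hμ, ae_restrict_mem measurableSet_domSet] with s hs hsD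
  calc jumpRate φ lam x μ s ≤ ∫⁻ _, ENNReal.ofReal (sSup (lam (φ x s) '' Uc (φ x s))) ∂(μ s) := by
        refine lintegral_mono_ae ?_
        filter_upwards [hs] with u hu
        rw [max_eq_left hsD.1]
        exact ENNReal.ofReal_le_ofReal (le_sSup_image_of_mem hUc hlamc (hE s hsD) hu)
    _ = _ := by simp

/-- The survival function is dominated by the one of any lower bound `ξ` of the jump rate. -/
theorem survival_le_exp_neg_integral {α : ℝ} (hα : 0 ≤ α) {I : ℝ → ℝ≥0∞} {q : ℝ → ℝ}
    (hqm : Measurable q) (hq0 : ∀ s, 0 ≤ q s) {t : ℝ} (ht : 0 ≤ t)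
    (hle : ∀ᵐ s ∂(volume.restrict (Ioc 0 t)), ENNReal.ofReal (q s) ≤ I s)
    (hfin : ∫⁻ s in Ioc 0 t, I s ≠ ⊤) :
    survival α I t ≤ Real.exp (-∫ s in (0:ℝ)..t, q s) := by
  have h1 : ∫ s in (0:ℝ)..t, q s ≤ (∫⁻ s in Ioc 0 t, I s).toReal := by
    rw [intervalIntegral.integral_of_le ht, integral_eq_lintegral_of_nonneg_ae
      (Eventually.of_forall hq0) hqm.aestronglyMeasurable]
    exact ENNReal.toReal_mono hfin (lintegral_mono_ae hle)
  have h2 : 0 ≤ α * t := mul_nonneg hα ht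
  exact Real.exp_le_exp.2 (by linarith)

end RelaxedControl

section SingleControl

variable [MeasurableSpace U] {E : Set (Rn n)} {φ : Rn n → ℝ → Rn n} {lam : Rn n → U → ℝ}
  {x : Rn n} {μ : ℝ → Measure U} {α : ℝ}

theorem nL_eq_lintegral_survival
    (hS : ∀ t, t ∈ domSet E φ x → rE φ lam α x μ t = survival α (jumpRate φ lam x μ) t) :
    nL E φ lam α x μ =
      ∫⁻ s in domSet E φ x, ENNReal.ofReal (survival α (jumpRate φ lam x μ) s) :=
  setLIntegral_congr_fun measurableSet_domSet fun s hs => by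
    simp only [hS s hs]

theorem rSurv_eq_of_tstar_ne_top (h : tstar E φ x ≠ ⊤)
    (hS : rE φ lam α x μ (tstar E φ x).toReal =
      survival α (jumpRate φ lam x μ) (tstar E φ x).toReal) :
    rSurv E φ lam α x μ = survival α (jumpRate φ lam x μ) (tstar E φ x).toReal := by
  rw [rSurv, if_pos h, hS]

theorem rSurv_eq_zero_of_tstar_eq_top (h : tstar E φ x = ⊤)
    (hS : ∀ t, t ∈ domSet E φ x → rE φ lam α x μ t = survival α (jumpRate φ lam x μ) t)
    (hL : nL E φ lam α x μ ≠ ⊤) : rSurv E φ lam α x μ = 0 := by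
  rw [nL_eq_lintegral_survival hS, domSet_of_tstar_eq_top h] at hL
  have himage : rE φ lam α x μ '' Ici 0 = survival α (jumpRate φ lam x μ) '' Ici 0 :=
    image_congr fun t ht => hS t (by rwa [domSet_of_tstar_eq_top h])
  rw [rSurv, if_neg (not_not.2 h), himage, sInf_survival_eq_zero hL]

theorem setLIntegral_rE_mul
    (hS : ∀ t, t ∈ domSet E φ x → rE φ lam α x μ t = survival α (jumpRate φ lam x μ) t)
    (g : Rn n → U → ℝ≥0∞) :
    ∫⁻ s in domSet E φ x, ENNReal.ofReal (rE φ lam α x μ s) * ∫⁻ u, g (φ x s) u ∂(μ s) =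
      ∫⁻ s in domSet E φ x, ENNReal.ofReal (survival α (jumpRate φ lam x μ) s) *
        ∫⁻ u, g (φ x (max s 0)) u ∂(μ s) :=
  setLIntegral_congr_fun measurableSet_domSet fun s hs => by
    simp only [hS s hs, max_eq_left hs.1]

/-- Total mass of the law of the first jump time, including the boundary jump and discounting. -/
theorem nLamTot_add_nL (hα : 0 ≤ α) (hI : Measurable (jumpRate φ lam x μ))
    (hS : ∀ t, t ∈ domSet E φ x → rE φ lam α x μ t = survival α (jumpRate φ lam x μ) t)
    (hfin : ∀ t, t ∈ domSet E φ x → ∫⁻ s in Ioc 0 t, jumpRate φ lam x μ s ≠ ⊤)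
    (hST : tstar E φ x ≠ ⊤ → rE φ lam α x μ (tstar E φ x).toReal =
      survival α (jumpRate φ lam x μ) (tstar E φ x).toReal)
    (hfinT : tstar E φ x ≠ ⊤ → ∫⁻ s in Ioc 0 (tstar E φ x).toReal, jumpRate φ lam x μ s ≠ ⊤)
    (hL : nL E φ lam α x μ ≠ ⊤) :
    nLamTot E φ lam α x μ + ENNReal.ofReal α * nL E φ lam α x μ = 1 := by
  have h1 := setLIntegral_rE_mul hS fun y u => ENNReal.ofReal (lam y u)
  rw [nLamTot, h1]
  change (∫⁻ s in domSet E φ x, ENNReal.ofReal (survival α (jumpRate φ lam x μ) s) *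
    jumpRate φ lam x μ s) + _ + _ = _
  by_cases h : tstar E φ x = ⊤
  · rw [rSurv_eq_zero_of_tstar_eq_top h hS hL]
    rw [nL_eq_lintegral_survival hS] at hL ⊢
    rw [domSet_of_tstar_eq_top h] at *
    simpa using lintegral_Ici_survival_mul_add hα hI (fun T hT => hfin T hT) hL
  · rw [rSurv_eq_of_tstar_ne_top h (hST h), nL_eq_lintegral_survival hS,
      ← setLIntegral_congr (Ioc_ae_eq_domSet h), ← setLIntegral_congr (Ioc_ae_eq_domSet h)]
    exact lintegral_survival_mul_add hα hI ENNReal.toReal_nonneg (hfinT h)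

end SingleControl

section PostJump

variable [MeasurableSpace U] {E : Set (Rn n)} {Q : Kernel (Rn n × U) (Rn n)}

/-- Bounded increasing approximations, on `E`, of the limit inferior of `ofReal (hk k + c)`. -/
def liminfApprox (E : Set (Rn n)) (hk : ℕ → Rn n → ℝ) (c : ℝ) (N : ℕ) (z : Rn n) : ℝ≥0∞ :=
  min (⨅ j ≥ N, ENNReal.ofReal (E.indicator (hk j) z + c)) N

variable {hk : ℕ → Rn n → ℝ} {c : ℝ}

theorem measurable_liminfApprox (hE : MeasurableSet E)
    (hkm : ∀ k, Measurable fun x : E => hk k x.1) (N : ℕ) :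
    Measurable (liminfApprox E hk c N) := by
  have h : ∀ k, Measurable (E.indicator (hk k)) := by
    intro k
    refine measurable_of_restrict_of_restrict_compl hE ?_ ?_
    · have : E.domRestrict (E.indicator (hk k)) = fun z : E => hk k z.1 := by
        ext z
        exact indicator_of_mem z.2 _
      rw [this]
      exact hkm k
    · have : Eᶜ.domRestrict (E.indicator (hk k)) = fun _ => 0 := by
        ext z
        exact indicator_of_notMem z.2 _
      rw [this]
      exact measurable_const
  refine Measurable.min (Measurable.biInf _ (to_countable _) fun j _ => ?_) measurable_const
  exact ((h j).add_const c).ennreal_ofReal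

theorem monotone_liminfApprox (z : Rn n) : Monotone fun N => liminfApprox E hk c N z :=
  fun N M hNM => min_le_min (biInf_mono fun j hj => le_trans hNM hj) (by simpa using hNM)

theorem liminfApprox_le_natCast (N : ℕ) (z : Rn n) : liminfApprox E hk c N z ≤ N :=
  min_le_right _ _

theorem liminfApprox_ne_top (N : ℕ) (z : Rn n) : liminfApprox E hk c N z ≠ ⊤ :=
  ((liminfApprox_le_natCast N z).trans_lt (ENNReal.natCast_lt_top N)).ne

theorem liminfApprox_le {N k : ℕ} (hNk : N ≤ k) {z : Rn n} (hz : z ∈ E) :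
    liminfApprox E hk c N z ≤ ENNReal.ofReal (hk k z + c) := by
  refine (min_le_left _ _).trans ((iInf₂_le k hNk).trans_eq ?_)
  rw [indicator_of_mem hz]

theorem ofReal_liminf_le_iSup_liminfApprox {z : Rn n} (hz : z ∈ E) (hb : ∀ k, -c ≤ hk k z) :
    ENNReal.ofReal (liminf (fun k => hk k z) atTop + c) ≤ ⨆ N, liminfApprox E hk c N z := by
  refine (liminf_ofReal_add_le hb).trans (le_of_forall_lt fun b hlt => ?_)
  rw [liminf_eq_iSup_iInf_of_nat] at hlt
  obtain ⟨N, hN⟩ := lt_iSup_iff.1 hlt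
  obtain ⟨M, hM⟩ := ENNReal.exists_nat_gt (hlt.trans_le le_top).ne
  refine lt_of_lt_of_le ?_ (le_iSup (fun N => liminfApprox E hk c N z) (max N M))
  refine lt_min (hN.trans_le ?_) (hM.trans_le (by simp))
  refine le_iInf₂ fun j hj => (iInf₂_le j (le_trans (le_max_left N M) hj)).trans_eq ?_
  rw [indicator_of_mem hz]

/-- The integral of the approximations against the post-jump kernel. -/
def liminfApproxQ (E : Set (Rn n)) (Q : Kernel (Rn n × U) (Rn n)) (hk : ℕ → Rn n → ℝ) (c : ℝ)
    (N : ℕ) (y : Rn n) (a : U) : ℝ≥0∞ :=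
  ∫⁻ z, liminfApprox E hk c N z ∂(Q (y, a))

theorem measurable_liminfApproxQ (hE : MeasurableSet E)
    (hkm : ∀ k, Measurable fun x : E => hk k x.1) (N : ℕ) :
    Measurable fun p : Rn n × U => liminfApproxQ E Q hk c N p.1 p.2 :=
  (measurable_liminfApprox hE hkm N).lintegral_kernel

theorem monotone_liminfApproxQ (y : Rn n) (a : U) :
    Monotone fun N => liminfApproxQ E Q hk c N y a :=
  fun _ _ hNM => lintegral_mono fun z => monotone_liminfApprox z hNM

theorem liminfApproxQ_ne_top [IsMarkovKernel Q] (N : ℕ) (y : Rn n) (a : U) :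
    liminfApproxQ E Q hk c N y a ≠ ⊤ := by
  have h : liminfApproxQ E Q hk c N y a ≤ ∫⁻ _, (N : ℝ≥0∞) ∂(Q (y, a)) :=
    lintegral_mono fun z => liminfApprox_le_natCast N z
  refine (h.trans_lt ?_).ne
  simp

theorem continuousOn_liminfApproxQ [TopologicalSpace U] [IsMarkovKernel Q] (hE : MeasurableSet E)
    (hkm : ∀ k, Measurable fun x : E => hk k x.1) {y : Rn n} {K : Set U}
    (hQ : ∀ g : Rn n → ℝ, Measurable g → (∃ C, ∀ z, |g z| ≤ C) →
      ContinuousOn (fun a => ∫ z, g z ∂(Q (y, a))) K) (N : ℕ) :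
    ContinuousOn (liminfApproxQ E Q hk c N y) K := by
  have hm := measurable_liminfApprox (c := c) hE hkm N
  have h := hQ (fun z => (liminfApprox E hk c N z).toReal) hm.ennreal_toReal ⟨N, fun z => by
    rw [abs_of_nonneg ENNReal.toReal_nonneg]
    exact ENNReal.toReal_le_of_le_ofReal (Nat.cast_nonneg N) (by
      simpa using liminfApprox_le_natCast N z)⟩
  have heq : ∀ a, liminfApproxQ E Q hk c N y a =
      ENNReal.ofReal (∫ z, (liminfApprox E hk c N z).toReal ∂(Q (y, a))) := by
    intro a
    rw [integral_toReal hm.aemeasurable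
      (Eventually.of_forall fun z => (liminfApprox_ne_top N z).lt_top)]
    exact (ENNReal.ofReal_toReal (liminfApproxQ_ne_top N y a)).symm
  exact (ENNReal.continuous_ofReal.comp_continuousOn h).congr fun a _ => heq a

theorem liminfApproxQ_le_nQp [IsMarkovKernel Q] (hE : MeasurableSet E) {N k : ℕ} (hNk : N ≤ k)
    {y : Rn n} {a : U} (hQ : Q (y, a) E = 1) :
    liminfApproxQ E Q hk c N y a ≤ nQp Q (hk k) c y a := by
  refine lintegral_mono_ae ?_
  filter_upwards [(prob_compl_eq_zero_iff hE).2 hQ] with z hz using liminfApprox_le hNk hz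

theorem nQp_liminf_le_iSup [IsMarkovKernel Q] (hE : MeasurableSet E)
    (hkm : ∀ k, Measurable fun x : E => hk k x.1) (hb : ∀ k, ∀ z ∈ E, -c ≤ hk k z)
    {y : Rn n} {a : U} (hQ : Q (y, a) E = 1) :
    nQp Q (fun z => liminf (fun k => hk k z) atTop) c y a ≤
      ⨆ N, liminfApproxQ E Q hk c N y a := by
  unfold liminfApproxQ
  rw [← lintegral_iSup (measurable_liminfApprox hE hkm) fun _ _ hNM z =>
    monotone_liminfApprox z hNM]
  refine lintegral_mono_ae ?_
  have hae : ∀ᵐ z ∂(Q (y, a)), z ∈ E := (prob_compl_eq_zero_iff hE).2 hQ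
  filter_upwards [hae] with z hz
  exact ofReal_liminf_le_iSup_liminfApprox hz fun k => hb k z hz

end PostJump

section ConvergentControls

theorem tendsto_survival {β : ℕ → ℝ} {α : ℝ} (hβ : Tendsto β atTop (𝓝 α))
    {I : ℕ → ℝ → ℝ≥0∞} {I' : ℝ → ℝ≥0∞} {t : ℝ} (hfin : ∫⁻ s in Ioc 0 t, I' s ≠ ⊤)
    (h : Tendsto (fun k => ∫⁻ s in Ioc 0 t, I k s) atTop (𝓝 (∫⁻ s in Ioc 0 t, I' s))) :
    Tendsto (fun k => survival (β k) (I k) t) atTop (𝓝 (survival α I' t)) :=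
  (Real.continuous_exp.tendsto _).comp
    ((hβ.mul_const t).neg.sub ((ENNReal.tendsto_toReal hfin).comp h))

theorem monotone_iInf_ge (u : ℕ → ℝ≥0∞) : Monotone fun N => ⨅ k ≥ N, u k :=
  fun _ _ hNM => biInf_mono fun _ hk => hNM.trans hk

theorem liminf_add_liminf_le (u v : ℕ → ℝ≥0∞) :
    liminf u atTop + liminf v atTop ≤ liminf (fun k => u k + v k) atTop := by
  simp only [liminf_eq_iSup_iInf_of_nat]
  rw [ENNReal.iSup_add_iSup_of_monotone (monotone_iInf_ge u) (monotone_iInf_ge v)]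
  exact iSup_mono fun N => le_iInf₂ fun k hk => add_le_add (iInf₂_le k hk) (iInf₂_le k hk)

theorem coe_sub_le_liminf {X : ℕ → ℝ≥0∞} {X' : ℝ≥0∞} (hX : X' ≤ liminf X atTop) {y : ℕ → ℝ}
    {y' : ℝ} (hy : Tendsto y atTop (𝓝 y')) :
    (X' : EReal) - (y' : EReal) ≤ liminf (fun k => (X k : EReal) - (y k : EReal)) atTop := by
  have h1 : (X' : EReal) ≤ liminf (fun k => (X k : EReal)) atTop := by
    have h := EReal.coe_ennreal_strictMono.monotone.map_liminf_of_continuousAt (F := atTop) X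
      continuous_coe_ennreal_ereal.continuousAt
    exact (EReal.coe_ennreal_strictMono.monotone hX).trans_eq h
  have h2 : liminf (fun k => -(y k : EReal)) atTop = -(y' : EReal) :=
    ((continuous_coe_real_ereal.tendsto _).comp hy).neg.liminf_eq
  rw [sub_eq_add_neg, ← h2]
  exact (add_le_add h1 le_rfl).trans EReal.le_liminf_add

variable [MetricSpace U] [MeasurableSpace U] [CompactSpace U] [BorelSpace U]

theorem RelaxedTendsto.tendsto_setLIntegral_Ioc {D : Set ℝ}
    {κ : ℕ → Kernel ℝ U} {η : Kernel ℝ U} [∀ k, IsMarkovKernel (κ k)] [IsMarkovKernel η]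
    (h : RelaxedTendsto (volume.restrict D) κ η) {K : ℝ → Set U}
    (hK : ∀ᵐ s ∂(volume.restrict D), ∀ᵐ u ∂((η + Kernel.sum κ) s), u ∈ K s)
    {l : ℝ → U → ℝ≥0∞} (hlm : Measurable (Function.uncurry l))
    (hlc : ∀ᵐ s ∂(volume.restrict D), ContinuousOn (l s) (K s)) {b : ℝ → ℝ≥0∞}
    (hb : ∀ᵐ s ∂(volume.restrict D), ∀ u ∈ K s, l s u ≤ b s) {t : ℝ}
    (ht : volume.restrict (Ioc 0 t) ≤ volume.restrict D)
    (hbfin : ∫⁻ s in Ioc 0 t, b s < ⊤) :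
    Tendsto (fun k => ∫⁻ s in Ioc 0 t, ∫⁻ u, l s u ∂(κ k s)) atTop
      (𝓝 (∫⁻ s in Ioc 0 t, ∫⁻ u, l s u ∂(η s))) := by
  have hr : (volume.restrict D).restrict (Ioc 0 t) = volume.restrict (Ioc 0 t) := by
    refine le_antisymm ?_ ?_
    · exact Measure.restrict_mono' (Eventually.of_forall fun _ h => h) Measure.restrict_le_self
    · have := Measure.restrict_mono' (s := Ioc (0:ℝ) t)
        (Eventually.of_forall fun _ (h : _ ∈ Ioc 0 t) => h) ht
      rwa [Measure.restrict_restrict measurableSet_Ioc, inter_self] at this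
  have hR := h.restrict (B := Ioc 0 t) measurableSet_Ioc
  rw [hr] at hR
  exact hR.tendsto_lintegral_of_dominated (ae_mono ht hK) hlm (ae_mono ht hlc) (ae_mono ht hb) hbfin

end ConvergentControls

/-- **Proposition 5.1 of the paper.**  For `α_k ↓ α ≥ 0`, functions `h_{α_k}` uniformly
bounded below by `−K_h` with pointwise liminf `h`, and relaxed controls `Θ_k ∈ 𝕍^r(x)`
converging to `Θ ∈ 𝕍^r(x)` (in the weak* sense on time-indexed measures and weakly on the
boundary measures), one has:
(a) `𝓛_{α_k}(x,Θ_k) → 𝓛_α(x,Θ)`, (b) `liminf L_{α_k} f(x,Θ_k) ≥ L_α f(x,Θ)`,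
(c) `liminf H_{α_k} r(x,Θ_k) ≥ H_α r(x,Θ)`, (d) `liminf G_{α_k} h_{α_k}(x,Θ_k) ≥ G_α h(x,Θ)`. -/
theorem convergence_lower_semicontinuity
    {n : ℕ} {U : Type*} [MetricSpace U] [CompactSpace U] [Nonempty U]
    [MeasurableSpace U] [BorelSpace U]
    (E : Set (Rn n)) (φ : Rn n → ℝ → Rn n) (Δ : Rn n) (Uc : Rn n → Set U)
    (lam f r : Rn n → U → ℝ) (Q : Kernel (Rn n × U) (Rn n))
    (hEopen : IsOpen E) (hEne : E.Nonempty) (hΔ : Δ ∈ frontier E)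
    (hφcont : ContinuousOn (fun p : Rn n × ℝ => φ p.1 p.2) (Set.univ ×ˢ Set.Ici 0))
    (hφ0 : ∀ y, φ y 0 = y)
    (hφsg : ∀ y : Rn n, ∀ t ≥ (0:ℝ), ∀ s ≥ (0:ℝ), φ y (t + s) = φ (φ y t) s)
    (hUcne : ∀ y ∈ closure E, (Uc y).Nonempty)
    (hUccpt : ∀ y ∈ closure E, IsCompact (Uc y))
    (hlamm : Measurable fun p : Rn n × U => lam p.1 p.2)
    (hlamnn : ∀ y a, 0 ≤ lam y a)
    (hQmk : IsMarkovKernel Q)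
    (hQE : ∀ y ∈ closure E, ∀ a : U, Q (y, a) E = 1)
    (hfm : Measurable fun p : Rn n × U => f p.1 p.2) (hfnn : ∀ y a, 0 ≤ f y a)
    (hrm : Measurable fun p : Rn n × U => r p.1 p.2) (hrnn : ∀ y a, 0 ≤ r y a)
    (hrate1 : ∀ x ∈ E, ∀ t : ℝ, 0 ≤ t → ENNReal.ofReal t < tstar E φ x →
      ∫⁻ s in Set.Ioc (0:ℝ) t, ENNReal.ofReal (sSup (lam (φ x s) '' Uc (φ x s))) < ⊤)
    (hrate2 : ∀ x ∈ E, tstar E φ x ≠ ⊤ →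
      ∫⁻ s in domSet E φ x, ENNReal.ofReal (sSup (lam (φ x s) '' Uc (φ x s))) < ⊤)
    (hlamc : ∀ y ∈ closure E, ContinuousOn (fun a => lam y a) (Uc y))
    (hfseq : ∃ fs : ℕ → Rn n → U → ℝ,
      (∀ j, Measurable fun p : Rn n × U => fs j p.1 p.2) ∧ (∀ j y a, 0 ≤ fs j y a) ∧
      (∀ j, ∀ y ∈ closure E, ContinuousOn (fs j y) (Uc y)) ∧
      (∀ y a, Monotone fun j => fs j y a) ∧
      (∀ y a, Tendsto (fun j => fs j y a) atTop (𝓝 (f y a))))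
    (hrseq : ∃ rs : ℕ → Rn n → U → ℝ,
      (∀ j, Measurable fun p : Rn n × U => rs j p.1 p.2) ∧ (∀ j z a, 0 ≤ rs j z a) ∧
      (∀ j, ∀ z ∈ frontier E, ContinuousOn (rs j z) (Uc z)) ∧
      (∀ z a, Monotone fun j => rs j z a) ∧
      (∀ z a, Tendsto (fun j => rs j z a) atTop (𝓝 (r z a))))
    (hQc : ∀ y ∈ closure E, ∀ g : Rn n → ℝ, Measurable g → (∃ C, ∀ z, |g z| ≤ C) →
      ContinuousOn (fun a => ∫ z, g z ∂(Q (y, a))) (Uc y))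
    (hxi : ∃ ξ : Rn n → ℝ, ∃ Kxi : ℝ, Measurable ξ ∧ (∀ y, 0 ≤ ξ y) ∧
      (∀ y ∈ E, ∀ a ∈ Uc y, ξ y ≤ lam y a) ∧
      (∀ x ∈ E, ∫⁻ t in domSet E φ x,
        ENNReal.ofReal (Real.exp (-(∫ s in (0:ℝ)..t, ξ (φ x s)))) ≤ ENNReal.ofReal Kxi) ∧
      (∀ x ∈ E, ∫⁻ t in domSet E φ x,
        ENNReal.ofReal (Real.exp (-(∫ s in (0:ℝ)..t, ξ (φ x s))) *
          sSup (f (φ x t) '' Uc (φ x t))) < ⊤))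
    (α : ℝ) (hα : 0 ≤ α) (a : ℕ → ℝ)
    (haanti : Antitone a) (hapos : ∀ k, 0 < a k) (halim : Tendsto a atTop (𝓝 α))
    (Kh : ℝ) (hKh : 0 ≤ Kh)
    (hk : ℕ → Rn n → ℝ)
    (hkm : ∀ k, Measurable fun x : E => hk k x.1)
    (hkb : ∀ k, ∀ y ∈ E, -Kh ≤ hk k y)
    (x : Rn n) (hx : x ∈ E)
    (Θn : ℕ → (ℝ → Measure U) × Measure U) (Θ : (ℝ → Measure U) × Measure U)
    (hΘn : ∀ k, Θn k ∈ RelSet E φ Δ Uc x) (hΘ : Θ ∈ RelSet E φ Δ Uc x)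
    (hconv : ∀ g : ℝ → U → ℝ, Measurable (fun p : ℝ × U => g p.1 p.2) →
      (∀ t : ℝ, Continuous (g t)) →
      Integrable (fun t => ⨆ u : U, |g t u|) (volume.restrict (Set.Ici (0:ℝ))) →
      Tendsto (fun k => ∫ t in Set.Ici (0:ℝ), ∫ u, g t u ∂((Θn k).1 t)) atTop
        (𝓝 (∫ t in Set.Ici (0:ℝ), ∫ u, g t u ∂(Θ.1 t))))
    (hconvb : ∀ g : U → ℝ, Continuous g →
      Tendsto (fun k => ∫ u, g u ∂((Θn k).2)) atTop (𝓝 (∫ u, g u ∂Θ.2))) :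
    Tendsto (fun k => nL E φ lam (a k) x ((Θn k).1)) atTop (𝓝 (nL E φ lam α x Θ.1)) ∧
    nLf E φ lam f α x Θ.1 ≤
      Filter.liminf (fun k => nLf E φ lam f (a k) x ((Θn k).1)) Filter.atTop ∧
    nH E φ Δ lam r α x Θ.1 Θ.2 ≤
      Filter.liminf (fun k => nH E φ Δ lam r (a k) x ((Θn k).1) ((Θn k).2)) Filter.atTop ∧
    eG E φ Δ lam Q (fun y => Filter.liminf (fun k => hk k y) Filter.atTop) Kh α x Θ.1 Θ.2 ≤
      Filter.liminf (fun k => eG E φ Δ lam Q (hk k) Kh (a k) x ((Θn k).1) ((Θn k).2))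
        Filter.atTop := by
  obtain ⟨fs, hfsm, hfs0, hfsc, hfsmono, hfslim⟩ := hfseq
  obtain ⟨rs, hrsm, hrs0, hrsc, hrsmono, hrslim⟩ := hrseq
  obtain ⟨ξ, Kxi, hξm, hξ0, hξle, hξint, -⟩ := hxi
  have hDE : ∀ s ∈ domSet E φ x, φ x s ∈ E := fun s hs =>
    flow_mem_of_mem_domSet hEopen hφcont (hφ0 x) hx hs
  have hP : ∀ k s, IsProbabilityMeasure ((Θn k).1 s) := fun k => (hΘn k).2.1
  have hP' : ∀ s, IsProbabilityMeasure (Θ.1 s) := hΘ.2.1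
  have hPb : ∀ k, IsProbabilityMeasure ((Θn k).2) := fun k => (hΘn k).2.2.2.1
  have hPb' : IsProbabilityMeasure Θ.2 := hΘ.2.2.2.1
  let κ : ℕ → Kernel ℝ U := fun k => ⟨(Θn k).1, (hΘn k).1⟩
  let η : Kernel ℝ U := ⟨Θ.1, hΘ.1⟩
  have hκM : ∀ k, IsMarkovKernel (κ k) := fun k => ⟨hP k⟩
  have hηM : IsMarkovKernel η := ⟨hP'⟩
  have hR : RelaxedTendsto (volume.restrict (domSet E φ x)) κ η := by
    have h0 : RelaxedTendsto (volume.restrict (Ici 0)) κ η :=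
      relaxedTendsto_of_forall_integrable_iSup hconv
    have h1 := h0.restrict (measurableSet_domSet (E := E) (φ := φ) (x := x))
    rwa [Measure.restrict_restrict measurableSet_domSet, inter_eq_left.2 domSet_subset_Ici] at h1
  have hKn : ∀ k, ∀ᵐ s ∂(volume.restrict (domSet E φ x)), ∀ᵐ u ∂((Θn k).1 s), u ∈ Uc (φ x s) :=
    fun k => ae_domSet_ae_mem hEopen hφcont (hφ0 x) hx hUccpt (hΘn k)
  have hK' : ∀ᵐ s ∂(volume.restrict (domSet E φ x)), ∀ᵐ u ∂(Θ.1 s), u ∈ Uc (φ x s) :=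
    ae_domSet_ae_mem hEopen hφcont (hφ0 x) hx hUccpt hΘ
  have hK : ∀ᵐ s ∂(volume.restrict (domSet E φ x)),
      ∀ᵐ u ∂((η + Kernel.sum κ) s), u ∈ Uc (φ x s) := by
    filter_upwards [hK', ae_all_iff.2 hKn] with s hs' hs
    rw [_root_.add_apply, Kernel.sum_apply, ae_add_measure_iff, Measure.ae_sum_iff]
    exact ⟨hs', hs⟩
  have hDmem : ∀ᵐ s ∂(volume.restrict (domSet E φ x)), s ∈ domSet E φ x :=
    ae_restrict_mem measurableSet_domSet
  set b : ℝ → ℝ≥0∞ := fun s => ENNReal.ofReal (sSup (lam (φ x s) '' Uc (φ x s)))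
  have hgood : ∀ t ∈ domSet E φ x, volume.restrict (Ioc 0 t) ≤ volume.restrict (domSet E φ x) ∧
      ∫⁻ s in Ioc 0 t, b s < ⊤ := fun t ht =>
    ⟨Measure.restrict_mono (Ioc_subset_Icc_self.trans (Icc_subset_domSet ht)) le_rfl,
      hrate1 x hx t ht.1 ht.2⟩
  have hgoodT : tstar E φ x ≠ ⊤ →
      volume.restrict (Ioc 0 (tstar E φ x).toReal) ≤ volume.restrict (domSet E φ x) ∧
      ∫⁻ s in Ioc 0 (tstar E φ x).toReal, b s < ⊤ := fun h => by
    rw [Measure.restrict_congr_set (Ioc_ae_eq_domSet h)]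
    exact ⟨le_rfl, hrate2 x hx h⟩
  have hfin : ∀ (μ : ℝ → Measure U), (∀ s, IsProbabilityMeasure (μ s)) →
      (∀ᵐ s ∂(volume.restrict (domSet E φ x)), ∀ᵐ u ∂(μ s), u ∈ Uc (φ x s)) → ∀ t,
      volume.restrict (Ioc 0 t) ≤ volume.restrict (domSet E φ x) ∧ ∫⁻ s in Ioc 0 t, b s < ⊤ →
      ∫⁻ s in Ioc 0 t, jumpRate φ lam x μ s ≠ ⊤ := by
    intro μ hμ hμK t ht
    exact ((lintegral_mono_ae (ae_mono ht.1
      (jumpRate_le_ofReal_sSup hμK hDE hUccpt hlamc))).trans_lt ht.2).ne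
  have hI : ∀ t, volume.restrict (Ioc 0 t) ≤ volume.restrict (domSet E φ x) ∧
      ∫⁻ s in Ioc 0 t, b s < ⊤ →
      Tendsto (fun k => survival (a k) (jumpRate φ lam x (Θn k).1) t) atTop
        (𝓝 (survival α (jumpRate φ lam x Θ.1) t)) := by
    intro t ht
    refine tendsto_survival halim (hfin _ hP' hK' t ht) ?_
    refine hR.tendsto_setLIntegral_Ioc hK
      (l := fun s u => ENNReal.ofReal (lam (φ x (max s 0)) u))
      (measurable_uncurry_flow_max hφcont x (g := fun y u => ENNReal.ofReal (lam y u))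
        hlamm.ennreal_ofReal) ?_ (b := b) ?_ ht.1 ht.2
    · filter_upwards [hDmem] with s hs
      rw [max_eq_left hs.1]
      exact ENNReal.continuous_ofReal.comp_continuousOn (hlamc _ (subset_closure (hDE s hs)))
    · filter_upwards [hDmem] with s hs u hu
      rw [max_eq_left hs.1]
      exact ENNReal.ofReal_le_ofReal (le_sSup_image_of_mem hUccpt hlamc (hDE s hs) hu)
  have hSn : ∀ k, ∀ t, t ∈ domSet E φ x →
      rE φ lam (a k) x (Θn k).1 t = survival (a k) (jumpRate φ lam x (Θn k).1) t := fun k t ht =>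
    rE_eq_survival hφcont hlamm hlamnn (hΘn k).1 (a k) ht.1 (hfin _ (hP k) (hKn k) t (hgood t ht))
  have hS : ∀ t, t ∈ domSet E φ x →
      rE φ lam α x Θ.1 t = survival α (jumpRate φ lam x Θ.1) t := fun t ht =>
    rE_eq_survival hφcont hlamm hlamnn hΘ.1 α ht.1 (hfin _ hP' hK' t (hgood t ht))
  have hSTn : ∀ k, tstar E φ x ≠ ⊤ → rE φ lam (a k) x (Θn k).1 (tstar E φ x).toReal =
      survival (a k) (jumpRate φ lam x (Θn k).1) (tstar E φ x).toReal := fun k h =>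
    rE_eq_survival hφcont hlamm hlamnn (hΘn k).1 (a k) ENNReal.toReal_nonneg
      (hfin _ (hP k) (hKn k) _ (hgoodT h))
  have hST : tstar E φ x ≠ ⊤ → rE φ lam α x Θ.1 (tstar E φ x).toReal =
      survival α (jumpRate φ lam x Θ.1) (tstar E φ x).toReal := fun h =>
    rE_eq_survival hφcont hlamm hlamnn hΘ.1 α ENNReal.toReal_nonneg
      (hfin _ hP' hK' _ (hgoodT h))
  set g : ℝ → ℝ≥0∞ := fun t => ENNReal.ofReal (Real.exp (-(∫ s in (0:ℝ)..t, ξ (φ x s))))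
  have hgfin : ∫⁻ t in domSet E φ x, g t ≠ ⊤ :=
    ((hξint x hx).trans_lt ENNReal.ofReal_lt_top).ne
  have hdom : ∀ (β : ℝ), 0 ≤ β → ∀ (μ : ℝ → Measure U), (∀ s, IsProbabilityMeasure (μ s)) →
      (∀ᵐ s ∂(volume.restrict (domSet E φ x)), ∀ᵐ u ∂(μ s), u ∈ Uc (φ x s)) →
      ∀ t ∈ domSet E φ x, ENNReal.ofReal (survival β (jumpRate φ lam x μ) t) ≤ g t := by
    intro β hβ μ hμ hμK t ht
    refine ENNReal.ofReal_le_ofReal ?_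
    have hint : ∫ s in (0:ℝ)..t, ξ (φ x s) = ∫ s in (0:ℝ)..t, ξ (φ x (max s 0)) := by
      refine intervalIntegral.integral_congr fun s hs => ?_
      rw [uIcc_of_le ht.1] at hs
      simp only [max_eq_left hs.1]
    rw [hint]
    refine survival_le_exp_neg_integral hβ
      (hξm.comp (continuous_flow_max hφcont x).measurable) (fun s => hξ0 _) ht.1 ?_
      (hfin μ hμ hμK t (hgood t ht))
    filter_upwards [ae_mono (hgood t ht).1 (ofReal_le_jumpRate hμK hDE hξle),
      ae_restrict_mem measurableSet_Ioc] with s hs hst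
    simpa [max_eq_left hst.1.le] using hs
  have hL : nL E φ lam α x Θ.1 ≠ ⊤ := by
    rw [nL_eq_lintegral_survival hS]
    exact ((setLIntegral_mono' measurableSet_domSet
      (hdom α hα Θ.1 hP' hK')).trans_lt hgfin.lt_top).ne
  have hLn : ∀ k, nL E φ lam (a k) x (Θn k).1 ≠ ⊤ := by
    intro k
    rw [nL_eq_lintegral_survival (hSn k)]
    exact ((setLIntegral_mono' measurableSet_domSet
      (hdom (a k) (hapos k).le _ (hP k) (hKn k))).trans_lt hgfin.lt_top).ne
  have hSlim : ∀ᵐ s ∂(volume.restrict (domSet E φ x)),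
      Tendsto (fun k => ENNReal.ofReal (survival (a k) (jumpRate φ lam x (Θn k).1) s)) atTop
        (𝓝 (ENNReal.ofReal (survival α (jumpRate φ lam x Θ.1) s))) := by
    filter_upwards [hDmem] with s hs
    exact ENNReal.tendsto_ofReal (hI s (hgood s hs))
  have hSm : ∀ k, Measurable fun s =>
      ENNReal.ofReal (survival (a k) (jumpRate φ lam x (Θn k).1) s) := fun k =>
    (measurable_survival _ _).ennreal_ofReal
  have hnL : Tendsto (fun k => nL E φ lam (a k) x ((Θn k).1)) atTop (𝓝 (nL E φ lam α x Θ.1)) := by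
    simp_rw [nL_eq_lintegral_survival hS, nL_eq_lintegral_survival (hSn _)]
    refine tendsto_lintegral_of_dominated_convergence g hSm (fun k => ?_) hgfin hSlim
    filter_upwards [hDmem] with s hs using hdom (a k) (hapos k).le _ (hP k) (hKn k) s hs
  have hrSurv : Tendsto (fun k => rSurv E φ lam (a k) x (Θn k).1) atTop
      (𝓝 (rSurv E φ lam α x Θ.1)) := by
    by_cases h : tstar E φ x = ⊤
    · simp_rw [rSurv_eq_zero_of_tstar_eq_top h hS hL,
        rSurv_eq_zero_of_tstar_eq_top h (hSn _) (hLn _)]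
      exact tendsto_const_nhds
    · simp_rw [rSurv_eq_of_tstar_ne_top h (hST h), rSurv_eq_of_tstar_ne_top h (hSTn _ h)]
      exact hI _ (hgoodT h)
  have hbd := flowBd_mem_frontier (x := x) hΔ hφcont
  have hbdcl := frontier_subset_closure hbd
  have hKbn : ∀ k, ∀ᵐ u ∂((Θn k).2), u ∈ Uc (flowBd E φ Δ x) := fun k =>
    ae_mem_of_measure_eq_one (hUccpt _ hbdcl) (hΘn k).2.2.2.2
  have hKb' : ∀ᵐ u ∂Θ.2, u ∈ Uc (flowBd E φ Δ x) :=
    ae_mem_of_measure_eq_one (hUccpt _ hbdcl) hΘ.2.2.2.2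
  refine ⟨hnL, ?_, ?_, ?_⟩
  · unfold nLf
    simp_rw [setLIntegral_rE_mul hS fun y u => ENNReal.ofReal (f y u),
      setLIntegral_rE_mul (hSn _) fun y u => ENNReal.ofReal (f y u)]
    refine hR.lintegral_weight_mul_le_liminf hK
      (e := fun k s => ENNReal.ofReal (survival (a k) (jumpRate φ lam x (Θn k).1) s))
      (e' := fun s => ENNReal.ofReal (survival α (jumpRate φ lam x Θ.1) s)) hSm
      (fun _ _ => ENNReal.ofReal_ne_top) (fun _ => ENNReal.ofReal_ne_top) hSlim
      (c := fun N s u => ENNReal.ofReal (fs N (φ x (max s 0)) u)) (fun N => ?_) (fun N => ?_) ?_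
      (f := fun s u => ENNReal.ofReal (f (φ x (max s 0)) u))
      (F := fun _ s u => ENNReal.ofReal (f (φ x (max s 0)) u)) ?_ ?_
    · exact measurable_uncurry_flow_max hφcont x (g := fun y u => ENNReal.ofReal (fs N y u))
        (hfsm N).ennreal_ofReal
    · filter_upwards [hDmem] with s hs
      rw [max_eq_left hs.1]
      exact ENNReal.continuous_ofReal.comp_continuousOn (hfsc N _ (subset_closure (hDE s hs)))
    · exact fun s u N M hNM => ENNReal.ofReal_le_ofReal (hfsmono _ _ hNM)
    · refine Eventually.of_forall fun s u => le_of_tendsto' (ENNReal.tendsto_ofReal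
        (hfslim (φ x (max s 0)) u)) fun N =>
          le_iSup (fun N => ENNReal.ofReal (fs N (φ x (max s 0)) u)) N
    · refine fun N k _ => Eventually.of_forall fun s u => ENNReal.ofReal_le_ofReal ?_
      exact (hfsmono _ _).ge_of_tendsto (hfslim _ _) N
  · refine mul_lintegral_le_liminf_of_tendsto_integral hconvb hKb' hKbn
      (fun _ => ENNReal.ofReal_ne_top) ENNReal.ofReal_ne_top (ENNReal.tendsto_ofReal hrSurv)
      (c := fun N u => ENNReal.ofReal (rs N (flowBd E φ Δ x) u)) (fun N => ?_) (fun N => ?_) ?_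
      (f := fun u => ENNReal.ofReal (r (flowBd E φ Δ x) u))
      (F := fun _ u => ENNReal.ofReal (r (flowBd E φ Δ x) u)) ?_ ?_
    · exact ((hrsm N).comp measurable_prodMk_left).ennreal_ofReal
    · exact ENNReal.continuous_ofReal.comp_continuousOn (hrsc N _ hbd)
    · exact fun u N M hNM => ENNReal.ofReal_le_ofReal (hrsmono _ _ hNM)
    · exact fun u => le_of_tendsto' (ENNReal.tendsto_ofReal (hrslim _ u)) fun N =>
        le_iSup (fun N => ENNReal.ofReal (rs N (flowBd E φ Δ x) u)) N
    · exact fun N k _ u => ENNReal.ofReal_le_ofReal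
        ((hrsmono _ _).ge_of_tendsto (hrslim _ _) N)
  · set h' : Rn n → ℝ := fun y => liminf (fun k => hk k y) atTop
    have hEm := hEopen.measurableSet
    have hint : ∫⁻ s in domSet E φ x, ENNReal.ofReal (rE φ lam α x Θ.1 s) *
          ∫⁻ u, ENNReal.ofReal (lam (φ x s) u) * nQp Q h' Kh (φ x s) u ∂(Θ.1 s) ≤
        liminf (fun k => ∫⁻ s in domSet E φ x, ENNReal.ofReal (rE φ lam (a k) x (Θn k).1 s) *
          ∫⁻ u, ENNReal.ofReal (lam (φ x s) u) * nQp Q (hk k) Kh (φ x s) u ∂((Θn k).1 s))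
          atTop := by
      simp_rw [setLIntegral_rE_mul hS fun y u => ENNReal.ofReal (lam y u) * nQp Q h' Kh y u,
        fun k => setLIntegral_rE_mul (hSn k) fun y u =>
          ENNReal.ofReal (lam y u) * nQp Q (hk k) Kh y u]
      refine hR.lintegral_weight_mul_le_liminf hK
        (e := fun k s => ENNReal.ofReal (survival (a k) (jumpRate φ lam x (Θn k).1) s))
        (e' := fun s => ENNReal.ofReal (survival α (jumpRate φ lam x Θ.1) s)) hSm
        (fun _ _ => ENNReal.ofReal_ne_top) (fun _ => ENNReal.ofReal_ne_top) hSlim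
        (c := fun N s u => ENNReal.ofReal (lam (φ x (max s 0)) u) *
          liminfApproxQ E Q hk Kh N (φ x (max s 0)) u) (fun N => ?_) (fun N => ?_) ?_
        (f := fun s u => ENNReal.ofReal (lam (φ x (max s 0)) u) *
          nQp Q h' Kh (φ x (max s 0)) u)
        (F := fun k s u => ENNReal.ofReal (lam (φ x (max s 0)) u) *
          nQp Q (hk k) Kh (φ x (max s 0)) u) ?_ ?_
      · exact measurable_uncurry_flow_max hφcont x
          (g := fun y u => ENNReal.ofReal (lam y u) * liminfApproxQ E Q hk Kh N y u)
          (hlamm.ennreal_ofReal.mul (measurable_liminfApproxQ hEm hkm N))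
      · filter_upwards [hDmem] with s hs
        rw [max_eq_left hs.1]
        have hcl := subset_closure (hDE s hs)
        exact (ENNReal.continuous_ofReal.comp_continuousOn (hlamc _ hcl)).ennreal_mul
          (continuousOn_liminfApproxQ hEm hkm (hQc _ hcl) N)
          (fun u _ => Or.inr (liminfApproxQ_ne_top N _ u)) (fun u _ => Or.inr ENNReal.ofReal_ne_top)
      · exact fun s u N M hNM => mul_le_mul' le_rfl (monotone_liminfApproxQ _ u hNM)
      · filter_upwards [hDmem] with s hs u
        rw [max_eq_left hs.1, ← ENNReal.mul_iSup]
        exact mul_le_mul' le_rfl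
          (nQp_liminf_le_iSup hEm hkm hkb (hQE _ (subset_closure (hDE s hs)) u))
      · intro N k hNk
        filter_upwards [hDmem] with s hs u
        rw [max_eq_left hs.1]
        exact mul_le_mul' le_rfl
          (liminfApproxQ_le_nQp hEm hNk (hQE _ (subset_closure (hDE s hs)) u))
    have hbdry : ENNReal.ofReal (rSurv E φ lam α x Θ.1) *
          ∫⁻ u, nQp Q h' Kh (flowBd E φ Δ x) u ∂Θ.2 ≤
        liminf (fun k => ENNReal.ofReal (rSurv E φ lam (a k) x (Θn k).1) *
          ∫⁻ u, nQp Q (hk k) Kh (flowBd E φ Δ x) u ∂((Θn k).2)) atTop :=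
      mul_lintegral_le_liminf_of_tendsto_integral hconvb hKb' hKbn
        (fun _ => ENNReal.ofReal_ne_top) ENNReal.ofReal_ne_top (ENNReal.tendsto_ofReal hrSurv)
        (c := fun N u => liminfApproxQ E Q hk Kh N (flowBd E φ Δ x) u)
        (fun N => (measurable_liminfApproxQ hEm hkm N).comp measurable_prodMk_left)
        (fun N => continuousOn_liminfApproxQ hEm hkm (hQc _ hbdcl) N)
        (fun u => monotone_liminfApproxQ _ u)
        (fun u => nQp_liminf_le_iSup hEm hkm hkb (hQE _ hbdcl u))
        (fun N k hNk u => liminfApproxQ_le_nQp hEm hNk (hQE _ hbdcl u))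
    have hnGp : nGp E φ Δ lam Q h' Kh α x Θ.1 Θ.2 ≤
        liminf (fun k => nGp E φ Δ lam Q (hk k) Kh (a k) x (Θn k).1 (Θn k).2) atTop :=
      (add_le_add hint hbdry).trans (liminf_add_liminf_le _ _)
    have htot : nLamTot E φ lam α x Θ.1 + ENNReal.ofReal α * nL E φ lam α x Θ.1 = 1 :=
      nLamTot_add_nL hα (measurable_jumpRate hφcont hlamm hΘ.1) hS
        (fun t ht => hfin _ hP' hK' t (hgood t ht)) hST (fun h => hfin _ hP' hK' _ (hgoodT h)) hL
    have htotn : ∀ k, nLamTot E φ lam (a k) x (Θn k).1 +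
        ENNReal.ofReal (a k) * nL E φ lam (a k) x (Θn k).1 = 1 := fun k =>
      nLamTot_add_nL (hapos k).le (measurable_jumpRate hφcont hlamm (hΘn k).1) (hSn k)
        (fun t ht => hfin _ (hP k) (hKn k) t (hgood t ht)) (hSTn k)
        (fun h => hfin _ (hP k) (hKn k) _ (hgoodT h)) (hLn k)
    have heq : ∀ {A B : ℝ≥0∞}, A + B = 1 → A = 1 - B ∧ A ≠ ⊤ := by
      intro A B hAB
      have hA : A ≠ ⊤ := fun h => by simp [h] at hAB
      have hB : B ≠ ⊤ := fun h => by simp [h] at hAB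
      exact ⟨ENNReal.eq_sub_of_add_eq hB hAB, hA⟩
    have hlamlim : Tendsto (fun k => nLamTot E φ lam (a k) x (Θn k).1) atTop
        (𝓝 (nLamTot E φ lam α x Θ.1)) := by
      simp_rw [(heq htot).1, fun k => (heq (htotn k)).1]
      exact ENNReal.Tendsto.sub tendsto_const_nhds
        (ENNReal.Tendsto.mul (ENNReal.tendsto_ofReal halim) (Or.inr hL) hnL
          (Or.inr ENNReal.ofReal_ne_top)) (Or.inl ENNReal.one_ne_top)
    have hcoe : ∀ {A : ℝ≥0∞}, A ≠ ⊤ →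
        (Kh : EReal) * (A : EReal) = ((Kh * A.toReal : ℝ) : EReal) := by
      intro A hA
      lift A to ℝ≥0 using hA
      rw [EReal.coe_mul, ENNReal.coe_toReal]
      rfl
    unfold eG
    simp_rw [hcoe (heq htot).2, fun k => hcoe (heq (htotn k)).2]
    exact coe_sub_le_liminf hnGp
      (((ENNReal.tendsto_toReal (heq htot).2).comp hlamlim).const_mul Kh)
end
end

section
/- Let g : [0,∞) → [0,∞] be Borel measurable. Then limsup_{α→0⁺} α ∫_0^∞ e^{−αs} g(s) ds ≤ limsup_{t→∞} (1/t) ∫_0^t g(s) ds, where the integrals are Lebesgue integrals with values in [0,∞] and the limit superiors are taken in [0,∞]. (This Abelian theorem, cited from Widder, is the content underlying Proposition 8.1 of the paper, which states limsup_{α↓0} α 𝒥_𝒟^α(x) ≤ 𝒥_𝒜(x) for the discounted and average value functions.) -/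
open MeasureTheory Filter Topology
open scoped ENNReal

/-- The tail of the exponential density of rate `α`. -/
lemma lintegral_Ioi_exponential_density {α : ℝ} (hα : 0 < α) (s : ℝ) :
    ∫⁻ t in Set.Ioi s, ENNReal.ofReal (α * Real.exp (-(α * t))) =
      ENNReal.ofReal (Real.exp (-(α * s))) := by
  have hneg : -α < 0 := neg_lt_zero.mpr hα
  have hint : IntegrableOn (fun t : ℝ => α * Real.exp (-(α * t))) (Set.Ioi s) := by
    simp only [← neg_mul]
    exact (integrableOn_exp_mul_Ioi hneg s).const_mul α
  rw [← ofReal_integral_eq_lintegral_ofReal hint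
    (ae_of_all _ fun t => by positivity), integral_const_mul]
  have h := integral_exp_mul_Ioi hneg s
  simp only [neg_mul] at h
  rw [h]
  congr 1
  field_simp

/-- The Laplace transform of `g` as an exponential average of the primitive of `g`. -/
lemma lintegral_exp_mul_eq_lintegral_primitive {α : ℝ} (hα : 0 < α) {g : ℝ → ℝ≥0∞}
    (hg : Measurable g) :
    ∫⁻ s in Set.Ioi (0 : ℝ), ENNReal.ofReal (Real.exp (-(α * s))) * g s =
      ∫⁻ t in Set.Ioi (0 : ℝ),
        ENNReal.ofReal (α * Real.exp (-(α * t))) * ∫⁻ s in Set.Ioc (0 : ℝ) t, g s := by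
  set k : ℝ → ℝ≥0∞ := fun t => ENNReal.ofReal (α * Real.exp (-(α * t))) with hk
  have hkm : Measurable k := by fun_prop
  have hF : Measurable ({p : ℝ × ℝ | p.1 ≤ p.2}.indicator fun p => k p.2 * g p.1) :=
    Measurable.indicator (by fun_prop) (measurableSet_le measurable_fst measurable_snd)
  calc
    _ = ∫⁻ s in Set.Ioi (0 : ℝ), ∫⁻ t in Set.Ioi (0 : ℝ),
          {p : ℝ × ℝ | p.1 ≤ p.2}.indicator (fun p => k p.2 * g p.1) (s, t) := by
      refine setLIntegral_congr_fun measurableSet_Ioi fun s hs => ?_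
      have hind : (fun t => {p : ℝ × ℝ | p.1 ≤ p.2}.indicator (fun p => k p.2 * g p.1) (s, t)) =
          (Set.Ici s).indicator fun t => k t * g s := rfl
      have hset : Set.Ici s ∩ Set.Ioi 0 = Set.Ici s :=
        Set.inter_eq_left.mpr fun t ht => (Set.mem_Ioi.mp hs).trans_le (Set.mem_Ici.mp ht)
      simp only [hind]
      rw [setLIntegral_indicator measurableSet_Ici, hset, lintegral_mul_const _ hkm,
        setLIntegral_congr Ioi_ae_eq_Ici.symm, lintegral_Ioi_exponential_density hα]
    _ = ∫⁻ t in Set.Ioi (0 : ℝ), ∫⁻ s in Set.Ioi (0 : ℝ),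
          {p : ℝ × ℝ | p.1 ≤ p.2}.indicator (fun p => k p.2 * g p.1) (s, t) :=
      lintegral_lintegral_swap hF.aemeasurable
    _ = _ := by
      refine lintegral_congr fun t => ?_
      have hind : (fun s => {p : ℝ × ℝ | p.1 ≤ p.2}.indicator (fun p => k p.2 * g p.1) (s, t)) =
          (Set.Iic t).indicator fun s => k t * g s := rfl
      rw [hind, setLIntegral_indicator measurableSet_Iic, Set.inter_comm, Set.Ioi_inter_Iic,
        lintegral_const_mul _ hg]

/-- If the primitive of `g` is at most `C + c t`, then its normalized Laplace transform
is at most `α C + c`. -/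
lemma ofReal_mul_lintegral_exp_mul_le {α : ℝ} (hα : 0 < α) {g : ℝ → ℝ≥0∞} (hg : Measurable g)
    {c C : ℝ≥0∞}
    (h : ∀ t : ℝ, 0 < t → ∫⁻ s in Set.Ioc (0 : ℝ) t, g s ≤ C + c * ENNReal.ofReal t) :
    ENNReal.ofReal α * ∫⁻ s in Set.Ioi (0 : ℝ), ENNReal.ofReal (Real.exp (-(α * s))) * g s ≤
      ENNReal.ofReal α * C + c := by
  have hkm : Measurable fun t : ℝ => ENNReal.ofReal (α * Real.exp (-(α * t))) := by fun_prop
  have hmass : ∫⁻ t in Set.Ioi (0 : ℝ), ENNReal.ofReal (α * Real.exp (-(α * t))) = 1 := by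
    simp [lintegral_Ioi_exponential_density hα]
  have hmean : ENNReal.ofReal α * ∫⁻ t in Set.Ioi (0 : ℝ),
      ENNReal.ofReal (α * Real.exp (-(α * t))) * (c * ENNReal.ofReal t) = c := by
    have hconst := lintegral_exp_mul_eq_lintegral_primitive hα (g := fun _ => c) measurable_const
    simp only [setLIntegral_const, Real.volume_Ioc, sub_zero] at hconst
    rw [← hconst, lintegral_mul_const _ (by fun_prop), ← mul_assoc,
      ← lintegral_const_mul _ (by fun_prop)]
    simp only [← ENNReal.ofReal_mul hα.le]
    rw [hmass, one_mul]
  calc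
    _ ≤ ENNReal.ofReal α * ∫⁻ t in Set.Ioi (0 : ℝ),
          ENNReal.ofReal (α * Real.exp (-(α * t))) * (C + c * ENNReal.ofReal t) := by
      rw [lintegral_exp_mul_eq_lintegral_primitive hα hg]
      gcongr ENNReal.ofReal α * ?_
      refine setLIntegral_mono (by fun_prop) fun t ht => ?_
      gcongr
      exact h t ht
    _ = ENNReal.ofReal α * C + c := by
      simp only [mul_add]
      rw [lintegral_add_left (by fun_prop), lintegral_mul_const _ hkm, hmass, one_mul, mul_add,
        hmean]

/-- **Abelian theorem** (underlying Proposition 8.1 of the paper): for every Borel measurable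
`g : [0,∞) → [0,∞]`,
`limsup_{α→0⁺} α ∫_0^∞ e^{−αs} g(s) ds ≤ limsup_{t→∞} (1/t) ∫_0^t g(s) ds`,
with the integrals (Lebesgue) and limit superiors taken in `[0,∞]`. -/
theorem abelian_limsup_le (g : ℝ → ℝ≥0∞) (hg : Measurable g) :
    Filter.limsup
      (fun α : ℝ =>
        ENNReal.ofReal α * ∫⁻ s in Set.Ioi (0:ℝ), ENNReal.ofReal (Real.exp (-(α * s))) * g s)
      (nhdsWithin 0 (Set.Ioi 0)) ≤
    Filter.limsup (fun t : ℝ => (∫⁻ s in Set.Ioc (0:ℝ) t, g s) / ENNReal.ofReal t)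
      Filter.atTop := by
  refine le_of_forall_gt_imp_ge_of_dense fun c hc => ?_
  rcases eq_or_ne c ∞ with rfl | hctop
  · exact le_top
  obtain ⟨T, hT⟩ := eventually_atTop.mp
    ((eventually_lt_of_limsup_lt hc).and (eventually_gt_atTop (0 : ℝ)))
  have hbound : ∀ t, T ≤ t → ∫⁻ s in Set.Ioc (0 : ℝ) t, g s ≤ c * ENNReal.ofReal t := by
    intro t ht
    obtain ⟨h1, h2⟩ := hT t ht
    exact (ENNReal.div_le_iff (by simpa using h2) ENNReal.ofReal_ne_top).mp h1.le
  have hprim : ∀ t : ℝ, 0 < t →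
      ∫⁻ s in Set.Ioc (0 : ℝ) t, g s ≤ c * ENNReal.ofReal T + c * ENNReal.ofReal t := by
    intro t _
    rcases le_total T t with h | h
    · exact (hbound t h).trans le_add_self
    · exact ((lintegral_mono_set (Set.Ioc_subset_Ioc_right h)).trans
        (hbound T le_rfl)).trans le_self_add
  have hlim : Tendsto (fun α : ℝ => ENNReal.ofReal α * (c * ENNReal.ofReal T) + c)
      (𝓝[>] 0) (𝓝 c) := by
    have h0 : Tendsto ENNReal.ofReal (𝓝[>] 0) (𝓝 0) := by
      simpa using (ENNReal.continuous_ofReal.tendsto 0).mono_left nhdsWithin_le_nhds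
    simpa using (ENNReal.Tendsto.mul_const h0
      (Or.inr (ENNReal.mul_ne_top hctop ENNReal.ofReal_ne_top))).add_const c
  calc
    _ ≤ limsup (fun α : ℝ => ENNReal.ofReal α * (c * ENNReal.ofReal T) + c) (𝓝[>] 0) :=
      limsup_le_limsup (eventually_mem_nhdsWithin.mono fun α hα =>
        ofReal_mul_lintegral_exp_mul_le hα hg hprim)
    _ = c := hlim.limsup_eq
end
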